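/- Let ψ ∈ F and β ∈ ℝ. Then there exists a constant C = C(ψ) > 0 such that for all n ∈ ℕ and all β ∈ ℝ, |E(C^ψ_{β,∞}; S_{n−1}) − (4/π²)·ψ(n)·ln⁺(η(ψ;n) − n)| ≤ C·ψ(n), where ln⁺(t) = max{ln t, 0}, η(ψ;n) = ψ⁻¹(ψ(n)/2), and S_{n−1}(f;x) = Σ_{k=0}^{n−1} A_k(f;x) is the Fourier sum of order n−1. -/

import Mathlib

open MeasureTheory Real Filter Set

noncomputable section

/-- The `k`-th Fourier cosine coefficient of a `2π`-periodic function. -/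
def fourierA (f : ℝ → ℝ) (k : ℕ) : ℝ := (1 / π) * ∫ t in (-π)..π, f t * Real.cos (k * t)

/-- The `k`-th Fourier sine coefficient of a `2π`-periodic function. -/
def fourierB (f : ℝ → ℝ) (k : ℕ) : ℝ := (1 / π) * ∫ t in (-π)..π, f t * Real.sin (k * t)

/-- The harmonicTerm `A_k(f;x)`. -/
def harmonicTerm (f : ℝ → ℝ) (k : ℕ) (x : ℝ) : ℝ :=
  if k = 0 then fourierA f 0 / 2
  else fourierA f k * Real.cos (k * x) + fourierB f k * Real.sin (k * x)

/-- `2π`-periodicity. -/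
def Periodic2pi (f : ℝ → ℝ) : Prop := ∀ x, f (x + 2 * π) = f x

/-- The set `S_∞`: measurable `2π`-periodic functions essentially bounded by 1. -/
def SInf (φ : ℝ → ℝ) : Prop :=
  Measurable φ ∧ Periodic2pi φ ∧ (∀ᵐ t ∂(volume : Measure ℝ), |φ t| ≤ 1)

/-- `φ` is the `(ψ,β)`-derivative of `f`: `φ ∈ S_∞` and the series
`Σ (1/ψ k)(a_k(f) cos(kx+βπ/2) + b_k(f) sin(kx+βπ/2))` is the Fourier series of `φ`. -/
def IsPsiDeriv (ψ : ℕ → ℝ) (β : ℝ) (f φ : ℝ → ℝ) : Prop :=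
  SInf φ ∧ fourierA φ 0 = 0 ∧
    ∀ k : ℕ, 1 ≤ k →
      fourierA φ k = (1 / ψ k) *
        (fourierA f k * Real.cos (β * π / 2) + fourierB f k * Real.sin (β * π / 2)) ∧
      fourierB φ k = (1 / ψ k) *
        (fourierB f k * Real.cos (β * π / 2) - fourierA f k * Real.sin (β * π / 2))

/-- The class `C^ψ_{β,∞}`. -/
def ClassC (ψ : ℕ → ℝ) (β : ℝ) (f : ℝ → ℝ) : Prop :=
  Continuous f ∧ Periodic2pi f ∧ ∃ φ, IsPsiDeriv ψ β f φ

/-- Multipliers of the sums `U^ψ_{n,p}` (with `φ(k) = (k-n+p)/ψ(k)`). -/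
def lambdaU (ψ : ℕ → ℝ) (n p k : ℕ) : ℝ :=
  if k ≤ n - p then 1
  else 1 - (((k : ℝ) - n + p) / ψ k) / ((p : ℝ) / ψ n)

/-- The sums `U^ψ_{n,p}(f;x)`. -/
def Usum (ψ : ℕ → ℝ) (n p : ℕ) (f : ℝ → ℝ) (x : ℝ) : ℝ :=
  ∑ k ∈ Finset.range n, lambdaU ψ n p k * harmonicTerm f k x

/-- `E(C^ψ_{β,∞}; T) = sup_{f ∈ C^ψ_{β,∞}} ‖f - T f‖_C`. -/
def classSup (ψ : ℕ → ℝ) (β : ℝ) (T : (ℝ → ℝ) → ℝ → ℝ) : ℝ :=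
  sSup {e | ∃ f, ClassC ψ β f ∧ e = ⨆ x : ℝ, |f x - T f x|}

/-- The characteristic `η(ψ;t) = ψ⁻¹(ψ(t)/2)` (inverse taken on `[1,∞)`). -/
def eta (ψ : ℝ → ℝ) (t : ℝ) : ℝ := Function.invFunOn ψ (Set.Ici 1) (ψ t / 2)

/-- The set `M`: positive convex functions on `[1,∞)` vanishing at infinity. -/
def MClass (ψ : ℝ → ℝ) : Prop :=
  (∀ t ≥ (1 : ℝ), 0 < ψ t) ∧ ConvexOn ℝ (Set.Ici 1) ψ ∧ Tendsto ψ atTop (nhds 0)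

/-- The set `F = {ψ ∈ M : η'(ψ;t) ≤ K for all t ≥ 1}`. -/
def FClass (ψ : ℝ → ℝ) : Prop :=
  MClass ψ ∧ ∃ K : ℝ, ∀ t ≥ (1 : ℝ), DifferentiableAt ℝ (eta ψ) t ∧ deriv (eta ψ) t ≤ K

/-- The Fourier sum `S_{n-1}(f;x) = Σ_{k=0}^{n-1} A_k(f;x)`. -/
def FourierSum (n : ℕ) (f : ℝ → ℝ) (x : ℝ) : ℝ :=
  ∑ k ∈ Finset.range n, harmonicTerm f k x

theorem sum_range_mul_eq_by_parts (b c : ℕ → ℝ) (m : ℕ) :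
    ∑ k ∈ Finset.range m, b k * c k = b m * ∑ k ∈ Finset.range m, c k +
      ∑ k ∈ Finset.range m, (b k - b (k + 1)) * ∑ i ∈ Finset.range (k + 1), c i := by
  induction m with
  | zero => simp
  | succ m ih =>
    rw [Finset.sum_range_succ, ih, Finset.sum_range_succ (fun k => (b k - b (k + 1)) * _),
      Finset.sum_range_succ c m]
    ring

theorem abs_sum_range_mul_le {b c : ℕ → ℝ} {B : ℝ} (hb : Antitone b) (hb0 : ∀ k, 0 ≤ b k)
    (hc : ∀ m, |∑ k ∈ Finset.range m, c k| ≤ B) (m : ℕ) :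
    |∑ k ∈ Finset.range m, b k * c k| ≤ b 0 * B := by
  rw [sum_range_mul_eq_by_parts]
  calc _ ≤ |b m * ∑ k ∈ Finset.range m, c k| +
        |∑ k ∈ Finset.range m, (b k - b (k + 1)) * ∑ i ∈ Finset.range (k + 1), c i| :=
        abs_add_le _ _
    _ ≤ b m * B + ∑ k ∈ Finset.range m, (b k - b (k + 1)) * B := by
        gcongr
        · rw [abs_mul, abs_of_nonneg (hb0 m)]
          exact mul_le_mul_of_nonneg_left (hc m) (hb0 m)
        · refine (Finset.abs_sum_le_sum_abs _ _).trans (Finset.sum_le_sum fun k _ => ?_)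
          have h : 0 ≤ b k - b (k + 1) := sub_nonneg.2 (hb k.le_succ)
          rw [abs_mul, abs_of_nonneg h]
          exact mul_le_mul_of_nonneg_left (hc _) h
    _ = b 0 * B := by
        rw [← Finset.sum_mul, Finset.sum_range_sub']
        ring

theorem two_mul_sin_half_mul_sum_cos (t γ : ℝ) (m : ℕ) :
    2 * sin (t / 2) * ∑ k ∈ Finset.range m, cos (k * t + γ) =
      sin ((m - 1 / 2) * t + γ) - sin (γ - t / 2) := by
  induction m with
  | zero =>
    have : ((0 : ℕ) - 1 / 2 : ℝ) * t + γ = γ - t / 2 := by push_cast; ring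
    rw [this]; simp
  | succ m ih =>
    rw [Finset.sum_range_succ, mul_add, ih]
    have h1 : ((m + 1 : ℕ) - 1 / 2 : ℝ) * t + γ = (m * t + γ) + t / 2 := by push_cast; ring
    have h2 : (m - 1 / 2 : ℝ) * t + γ = (m * t + γ) - t / 2 := by ring
    rw [h1, h2, sin_add, sin_sub]
    ring

theorem abs_sum_cos_le {t : ℝ} (ht : 0 < sin (t / 2)) (γ : ℝ) (m : ℕ) :
    |∑ k ∈ Finset.range m, cos (k * t + γ)| ≤ 1 / sin (t / 2) := by
  have h := two_mul_sin_half_mul_sum_cos t γ m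
  have habs : ∀ x : ℝ, |x| * sin (t / 2) = |x * sin (t / 2)| := fun x => by
    rw [abs_mul, abs_of_pos ht]
  rw [le_div_iff₀ ht, habs]
  have h1 := abs_le.1 (abs_sin_le_one ((m - 1 / 2) * t + γ))
  have h2 := abs_le.1 (abs_sin_le_one (γ - t / 2))
  rw [abs_le]
  constructor <;> nlinarith

theorem abs_sum_mul_cos_le {b : ℕ → ℝ} (hb : Antitone b) (hb0 : ∀ k, 0 ≤ b k) {t : ℝ}
    (ht : 0 < sin (t / 2)) (γ : ℝ) (m : ℕ) :
    |∑ k ∈ Finset.range m, b k * cos (k * t + γ)| ≤ b 0 / sin (t / 2) := by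
  have := abs_sum_range_mul_le hb hb0 (abs_sum_cos_le ht γ) m
  rwa [mul_one_div] at this

/-- For convex coefficients the first Abel summation isolates the leading term of a cosine sum. -/
theorem abs_sum_mul_cos_add_le {b : ℕ → ℝ} (hb : Antitone b) (hb0 : ∀ k, 0 ≤ b k)
    (hconv : Antitone fun k => b k - b (k + 1)) {t : ℝ}
    (ht : 0 < sin (t / 2)) (γ : ℝ) (m : ℕ) :
    |∑ k ∈ Finset.range m, b k * cos (k * t + γ) +
        b 0 * sin (γ - t / 2) / (2 * sin (t / 2))| ≤
      b m / (2 * sin (t / 2)) + (b 0 - b 1) / (2 * sin (t / 2) ^ 2) := by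
  have key : ∑ k ∈ Finset.range m, b k * cos (k * t + γ) +
        b 0 * sin (γ - t / 2) / (2 * sin (t / 2)) =
      (b m * sin ((m - 1 / 2) * t + γ) + ∑ k ∈ Finset.range m,
        (b k - b (k + 1)) * cos (k * t + (γ + t / 2 - π / 2))) / (2 * sin (t / 2)) := by
    rw [eq_div_iff (by positivity), add_mul, div_mul_cancel₀ _ (by positivity),
      sum_range_mul_eq_by_parts, add_mul, Finset.sum_mul]
    have h1 : ∀ m : ℕ, (∑ k ∈ Finset.range m, cos (k * t + γ)) * (2 * sin (t / 2)) =
        sin ((m - 1 / 2) * t + γ) - sin (γ - t / 2) := fun m => by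
      rw [mul_comm, two_mul_sin_half_mul_sum_cos]
    have h2 : ∀ k ∈ Finset.range m, (b k - b (k + 1)) *
        (∑ i ∈ Finset.range (k + 1), cos (i * t + γ)) * (2 * sin (t / 2)) =
        (b k - b (k + 1)) * cos (k * t + (γ + t / 2 - π / 2)) -
          (b k - b (k + 1)) * sin (γ - t / 2) := fun k _ => by
      have h3 : k * t + (γ + t / 2 - π / 2) = ((k + 1 : ℕ) - 1 / 2) * t + γ - π / 2 := by
        push_cast; ring
      rw [mul_assoc, h1, h3, cos_sub_pi_div_two]
      ring
    rw [Finset.sum_congr rfl h2, mul_assoc, h1, Finset.sum_sub_distrib, ← Finset.sum_mul,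
      Finset.sum_range_sub']
    ring
  rw [key, abs_div, abs_of_pos (show 0 < 2 * sin (t / 2) by positivity)]
  have h4 := abs_sum_mul_cos_le hconv (fun k => sub_nonneg.2 (hb k.le_succ)) ht
    (γ + t / 2 - π / 2) m
  have h5 : b m / (2 * sin (t / 2)) + (b 0 - b 1) / (2 * sin (t / 2) ^ 2) =
      (b m + (b 0 - b 1) / sin (t / 2)) / (2 * sin (t / 2)) := by
    field_simp
  rw [h5]
  gcongr
  refine (abs_add_le _ _).trans (add_le_add ?_ h4)
  rw [abs_mul, abs_of_nonneg (hb0 m)]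
  exact mul_le_of_le_one_right (hb0 m) (abs_sin_le_one _)

theorem div_pi_le_sin_half {t : ℝ} (h0 : 0 < t) (hπ : t ≤ π) : t / π ≤ sin (t / 2) := by
  have h := mul_le_sin (x := t / 2) (by positivity) (by linarith)
  calc t / π = 2 / π * (t / 2) := by ring
    _ ≤ _ := h

theorem sin_half_pos {t : ℝ} (h0 : 0 < t) (hπ : t ≤ π) : 0 < sin (t / 2) :=
  (div_pos h0 pi_pos).trans_le (div_pi_le_sin_half h0 hπ)

theorem abs_inv_two_mul_sin_half_sub_le {t : ℝ} (h0 : 0 < t) (hπ : t ≤ π) :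
    |1 / (2 * sin (t / 2)) - 1 / t| ≤ 1 := by
  have hs := sin_half_pos h0 hπ
  have hle : sin (t / 2) ≤ t / 2 := sin_le (by positivity)
  have hlow := div_pi_le_sin_half h0 hπ
  have hcos : 1 - (t / 2) ^ 2 / 2 ≤ cos (t / 2) := one_sub_sq_div_two_le_cos
  have htan : t / 2 * cos (t / 2) ≤ sin (t / 2) := by
    rcases hπ.lt_or_eq with h | h
    · have hc : 0 < cos (t / 2) := cos_pos_of_mem_Ioo ⟨by linarith, by linarith⟩
      have := lt_tan (x := t / 2) (by positivity) (by linarith)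
      rw [tan_eq_sin_div_cos, lt_div_iff₀ hc] at this
      exact this.le
    · rw [h, cos_pi_div_two]; simp
  have hdiff : 1 / (2 * sin (t / 2)) - 1 / t = (t - 2 * sin (t / 2)) / (2 * sin (t / 2) * t) := by
    field_simp
  rw [hdiff, abs_of_nonneg (by apply div_nonneg; linarith; positivity), div_le_one (by positivity)]
  have h1 : t - 2 * sin (t / 2) ≤ t ^ 3 / 8 := by nlinarith
  have h2 : t ^ 3 / 8 ≤ 2 * (t / π) * t := by
    rw [show 2 * (t / π) * t = 2 * t ^ 2 / π by ring, le_div_iff₀ pi_pos]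
    have : t * π ≤ 16 := by nlinarith [pi_lt_four, pi_pos]
    nlinarith [sq_nonneg t]
  nlinarith

theorem sum_range_rpow_neg_le {r : ℝ} (h0 : 0 < r) (h1 : r ≤ 1 / 2) (s : ℕ) :
    ∑ k ∈ Finset.range s, ((k : ℝ) + 1) ^ (-r) ≤ 2 * (s : ℝ) ^ (1 - r) := by
  induction s with
  | zero => simp [zero_rpow (by linarith : 1 - r ≠ 0)]
  | succ s ih =>
    rw [Finset.sum_range_succ]
    have hs : (0 : ℝ) < s + 1 := by positivity
    have hb := rpow_one_add_le_one_add_mul_self (s := -(1 / ((s : ℝ) + 1))) (p := 1 - r)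
      (by rw [neg_le_neg_iff, div_le_one hs]; linarith [s.cast_nonneg (α := ℝ)])
      (by linarith) (by linarith)
    have h2 : 1 + -(1 / ((s : ℝ) + 1)) = s / (s + 1) := by field_simp; norm_num
    rw [h2, div_rpow (by positivity) hs.le, div_le_iff₀ (by positivity)] at hb
    have h3 : ((s : ℝ) + 1) ^ (-r) = ((s : ℝ) + 1) ^ (1 - r) / (s + 1) := by
      rw [show 1 - r = -r + 1 by ring, rpow_add_one hs.ne']; field_simp
    push_cast
    have h4 : (s : ℝ) ^ (1 - r) ≤ ((s : ℝ) + 1) ^ (1 - r) - (1 - r) * ((s : ℝ) + 1) ^ (-r) := by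
      rw [h3]; exact hb.trans (le_of_eq (by ring))
    have h5 : 0 ≤ ((s : ℝ) + 1) ^ (-r) := by positivity
    nlinarith

theorem abs_sum_mul_cos_le_rpow {b : ℕ → ℝ} (hb : Antitone b) (hb0 : ∀ k, 0 ≤ b k)
    {Q r : ℝ} (h0 : 0 < r) (h1 : r ≤ 1 / 2) (hQ : ∀ k : ℕ, b k ≤ Q * ((k : ℝ) + 1) ^ (-r))
    {t : ℝ} (ht : 0 < t) (hπ : t ≤ π) (γ : ℝ) (m : ℕ) :
    |∑ k ∈ Finset.range m, b k * cos (k * t + γ)| ≤ 6 * Q * t ^ (r - 1) := by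
  have hQ0 : 0 ≤ Q := by simpa using (hb0 0).trans (hQ 0)
  set s := ⌊1 / t⌋₊ with hs
  have hs1 : (s : ℝ) ≤ 1 / t := Nat.floor_le (by positivity)
  have hs2 : 1 / t ≤ (s : ℝ) + 1 := (Nat.lt_floor_add_one _).le
  have hrpow : (1 / t) ^ (1 - r) = t ^ (r - 1) := by
    rw [one_div, inv_rpow ht.le, ← rpow_neg ht.le, neg_sub]
  have hhead : ∀ l ≤ s, |∑ k ∈ Finset.range l, b k * cos (k * t + γ)| ≤
      2 * Q * t ^ (r - 1) := fun l hl => by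
    calc _ ≤ ∑ k ∈ Finset.range l, |b k * cos (k * t + γ)| := Finset.abs_sum_le_sum_abs _ _
      _ ≤ ∑ k ∈ Finset.range l, Q * ((k : ℝ) + 1) ^ (-r) := by
          refine Finset.sum_le_sum fun k _ => ?_
          rw [abs_mul, abs_of_nonneg (hb0 k)]
          exact (mul_le_of_le_one_right (hb0 k) (abs_cos_le_one _)).trans (hQ k)
      _ ≤ Q * (2 * (l : ℝ) ^ (1 - r)) := by
          rw [← Finset.mul_sum]; gcongr; exact sum_range_rpow_neg_le h0 h1 l
      _ ≤ Q * (2 * (1 / t) ^ (1 - r)) := by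
          gcongr
          · linarith
          · exact (Nat.cast_le.2 hl).trans hs1
      _ = _ := by rw [hrpow]; ring
  have hT0 : 0 ≤ Q * t ^ (r - 1) := by positivity
  rcases le_total m s with hm | hm
  · exact (hhead m hm).trans (by linarith)
  obtain ⟨l, rfl⟩ := Nat.exists_eq_add_of_le hm
  rw [Finset.sum_range_add]
  have htail : |∑ k ∈ Finset.range l, b (s + k) * cos ((s + k : ℕ) * t + γ)| ≤
      4 * Q * t ^ (r - 1) := by
    have h := abs_sum_mul_cos_le (b := fun k => b (s + k))
      (fun i j hij => hb (by omega)) (fun k => hb0 _) (sin_half_pos ht hπ) (s * t + γ) l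
    have h' : ∀ k : ℕ, (k : ℝ) * t + (s * t + γ) = (s + k : ℕ) * t + γ := fun k => by
      push_cast; ring
    simp only [h'] at h
    refine h.trans ?_
    calc b (s + 0) / sin (t / 2) ≤ (Q * ((s : ℝ) + 1) ^ (-r)) / (t / π) := by
          gcongr
          · exact hQ s
          · exact div_pi_le_sin_half ht hπ
      _ ≤ (Q * (1 / t) ^ (-r)) / (t / π) := by
          gcongr Q * ?_ / _
          exact rpow_le_rpow_of_nonpos (by positivity) hs2 (by linarith)
      _ = π * (Q * t ^ (r - 1)) := by
          rw [one_div, inv_rpow ht.le, ← rpow_neg ht.le, neg_neg, rpow_sub_one ht.ne']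
          field_simp
      _ ≤ 4 * Q * t ^ (r - 1) := by nlinarith [pi_lt_four]
  exact (abs_add_le _ _).trans (by linarith [hhead s le_rfl])

theorem exists_abs_integral_abs_sin_sub_le :
    ∃ B > 0, ∀ u : ℝ, |∫ v in (0 : ℝ)..u, (|sin v| - 2 / π)| ≤ B := by
  have hcont : Continuous fun v : ℝ => |sin v| - 2 / π := by fun_prop
  have hper : Function.Periodic (fun v : ℝ => |sin v| - 2 / π) π := fun v => by
    simp [sin_add_pi]
  have hzero : ∫ v in (0 : ℝ)..π, (|sin v| - 2 / π) = 0 := by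
    rw [intervalIntegral.integral_sub (by apply Continuous.intervalIntegrable; fun_prop)
      (by simp)]
    have h : ∫ v in (0 : ℝ)..π, |sin v| = ∫ v in (0 : ℝ)..π, sin v := by
      refine intervalIntegral.integral_congr fun v hv => ?_
      rw [uIcc_of_le pi_pos.le] at hv
      exact abs_of_nonneg (sin_nonneg_of_mem_Icc hv)
    rw [h, integral_sin, intervalIntegral.integral_const]
    simp only [cos_zero, cos_pi, smul_eq_mul]
    rw [sub_zero, mul_div_cancel₀ _ pi_pos.ne']
    norm_num
  have hprim : Continuous fun u : ℝ => ∫ v in (0 : ℝ)..u, (|sin v| - 2 / π) :=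
    intervalIntegral.continuous_primitive (fun a b => hcont.intervalIntegrable a b) 0
  have hprim_per : Function.Periodic (fun u : ℝ => ∫ v in (0 : ℝ)..u, (|sin v| - 2 / π)) π :=
    fun u => by
      have h1 := hper.intervalIntegral_add_eq u 0
      rw [zero_add, hzero] at h1
      have h2 := intervalIntegral.integral_add_adjacent_intervals
        (hcont.intervalIntegrable (μ := volume) 0 u) (hcont.intervalIntegrable u (u + π))
      show ∫ v in (0 : ℝ)..(u + π), (|sin v| - 2 / π) = _
      rw [← h2, h1, add_zero]
  obtain ⟨B, hB⟩ := isCompact_Icc.exists_bound_of_continuousOn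
    (hprim.continuousOn (s := Icc 0 π))
  refine ⟨max B 1, by positivity, fun u => ?_⟩
  obtain ⟨y, hy, hyu⟩ := hprim_per.exists_mem_Ico₀ pi_pos u
  have := hB y ⟨hy.1, hy.2.le⟩
  rw [Real.norm_eq_abs] at this
  calc _ = |∫ v in (0 : ℝ)..y, (|sin v| - 2 / π)| := by rw [hyu]
    _ ≤ _ := this.trans (le_max_left _ _)

theorem integral_inv_sq_le {N : ℝ} (hN : 1 ≤ N) : ∫ t in (1 / N)..π, (t ^ 2)⁻¹ ≤ N := by
  have hN0 : 0 < N := by linarith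
  have haπ : 1 / N ≤ π := by
    have : 1 / N ≤ 1 := by rw [div_le_one hN0]; exact hN
    linarith [pi_gt_three]
  have hpos : ∀ t ∈ uIcc (1 / N) π, 0 < t := fun t ht => by
    rw [uIcc_of_le haπ] at ht; exact (by positivity : 0 < 1 / N).trans_le ht.1
  have h3 : ∫ t in (1 / N)..π, (t ^ 2)⁻¹ = -π⁻¹ - -(1 / N)⁻¹ := by
    refine intervalIntegral.integral_eq_sub_of_hasDerivAt (f := fun t => -t⁻¹)
      (fun t ht => (neg_neg ((t ^ 2)⁻¹)) ▸ (hasDerivAt_inv (hpos t ht).ne').neg) ?_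
    exact ((continuousOn_id.pow 2).inv₀ fun t ht =>
      pow_ne_zero 2 (hpos t ht).ne').intervalIntegrable
  rw [h3, one_div, inv_inv]
  have : 0 < π⁻¹ := by positivity
  linarith

theorem exists_abs_integral_abs_sin_div_sub_log_le :
    ∃ C > 0, ∀ w > 0, ∀ γ : ℝ, ∀ N ≥ (1 : ℝ),
      |(∫ t in (1 / N)..π, |sin (w * t + γ)| / t) - 2 / π * log N| ≤ C * (1 + N / w) := by
  obtain ⟨B, hB0, hB⟩ := exists_abs_integral_abs_sin_sub_le
  refine ⟨3 * B + 2, by positivity, fun w hw γ N hN => ?_⟩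
  have hN0 : 0 < N := by linarith
  have ha : 0 < 1 / N := by positivity
  have haπ : 1 / N ≤ π := by
    have : 1 / N ≤ 1 := by rw [div_le_one hN0]; exact hN
    linarith [pi_gt_three]
  have hpos : ∀ t ∈ uIcc (1 / N) π, 0 < t := fun t ht => by
    rw [uIcc_of_le haπ] at ht; exact ha.trans_le ht.1
  set h : ℝ → ℝ := fun v => |sin v| - 2 / π with hh
  have hcont : Continuous h := by fun_prop
  set H : ℝ → ℝ := fun u => ∫ v in (0 : ℝ)..u, h v with hH
  have hHd : ∀ u, HasDerivAt H (h u) u := fun u =>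
    intervalIntegral.integral_hasDerivAt_right (hcont.intervalIntegrable _ _)
      (hcont.stronglyMeasurableAtFilter _ _) hcont.continuousAt
  have hHc : Continuous H := continuous_iff_continuousAt.2 fun u => (hHd u).continuousAt
  have hGd : ∀ t, HasDerivAt (fun t => H (w * t + γ) / w) (h (w * t + γ)) t := fun t => by
    have h1 : HasDerivAt (fun t : ℝ => w * t + γ) w t := by
      simpa using ((hasDerivAt_id t).const_mul w).add_const γ
    have := ((hHd (w * t + γ)).comp t h1).div_const w
    rwa [mul_div_cancel_right₀ _ hw.ne'] at this
  have hinv : ∀ t ∈ uIcc (1 / N) π, HasDerivAt (fun t : ℝ => t⁻¹) (-(t ^ 2)⁻¹) t :=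
    fun t ht => hasDerivAt_inv (hpos t ht).ne'
  have hcinv2 : ContinuousOn (fun t : ℝ => (t ^ 2)⁻¹) (uIcc (1 / N) π) :=
    (continuousOn_id.pow 2).inv₀ fun t ht => pow_ne_zero 2 (hpos t ht).ne'
  have hcinv : ContinuousOn (fun t : ℝ => -(t ^ 2)⁻¹) (uIcc (1 / N) π) :=
    hcinv2.neg
  have hparts := intervalIntegral.integral_mul_deriv_eq_deriv_mul hinv (fun t _ => hGd t)
    hcinv.intervalIntegrable
    ((hcont.comp (by fun_prop : Continuous fun t : ℝ => w * t + γ)).intervalIntegrable _ _)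
  have hcinv1 : ContinuousOn (fun t : ℝ => t⁻¹) (uIcc (1 / N) π) :=
    continuousOn_id.inv₀ fun t ht => (hpos t ht).ne'
  have hsplit : (∫ t in (1 / N)..π, |sin (w * t + γ)| / t) =
      (∫ t in (1 / N)..π, t⁻¹ * h (w * t + γ)) + ∫ t in (1 / N)..π, 2 / π * t⁻¹ := by
    rw [← intervalIntegral.integral_add]
    · refine intervalIntegral.integral_congr fun t _ => ?_
      simp only [hh]; ring
    · exact (hcinv1.mul (by fun_prop)).intervalIntegrable
    · exact (continuousOn_const.mul hcinv1).intervalIntegrable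
  have hGb : ∀ t, |H (w * t + γ) / w| ≤ B / w := fun t => by
    rw [abs_div, abs_of_pos hw]; gcongr; exact hB _
  have hint : |∫ t in (1 / N)..π, -(t ^ 2)⁻¹ * (H (w * t + γ) / w)| ≤ B / w * N := by
    have h1 : ∀ t ∈ Ioc (1 / N) π, ‖-(t ^ 2)⁻¹ * (H (w * t + γ) / w)‖ ≤ (B / w) * (t ^ 2)⁻¹ :=
      fun t ht => by
        rw [Real.norm_eq_abs, abs_mul, abs_neg, abs_of_nonneg (by positivity), mul_comm]
        gcongr; exact hGb t
    have h2 := intervalIntegral.norm_integral_le_of_norm_le (μ := volume) haπ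
      (Filter.Eventually.of_forall h1) (continuousOn_const.mul hcinv2).intervalIntegrable
    rw [Real.norm_eq_abs] at h2
    refine h2.trans ?_
    rw [intervalIntegral.integral_const_mul]
    gcongr
    exact integral_inv_sq_le hN
  have hlog : ∫ t in (1 / N)..π, 2 / π * t⁻¹ = 2 / π * (log π + log N) := by
    rw [intervalIntegral.integral_const_mul, integral_inv_of_pos ha pi_pos,
      show π / (1 / N) = π * N by field_simp, log_mul pi_pos.ne' hN0.ne']
  have hlogπ : |2 / π * log π| ≤ 2 := by
    have h0 : 0 ≤ log π := log_nonneg (by linarith [pi_gt_three])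
    rw [abs_of_nonneg (by positivity), div_mul_eq_mul_div, div_le_iff₀ pi_pos]
    linarith [log_le_sub_one_of_pos pi_pos]
  rw [hsplit, hlog, hparts]
  have e1 : |π⁻¹ * (H (w * π + γ) / w)| ≤ B / w := by
    rw [abs_mul, abs_of_pos (inv_pos.2 pi_pos)]
    refine (mul_le_of_le_one_left (abs_nonneg _) ?_).trans (hGb _)
    exact inv_le_one_of_one_le₀ (by linarith [pi_gt_three])
  have e2 : |(1 / N)⁻¹ * (H (w * (1 / N) + γ) / w)| ≤ N * (B / w) := by
    rw [abs_mul, one_div, inv_inv, abs_of_pos hN0]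
    gcongr
    exact hGb _
  rw [abs_le] at *
  have e3 : B / w ≤ N * (B / w) := le_mul_of_one_le_left (by positivity) hN
  have e4 : (3 * B + 2) * (1 + N / w) = 3 * B + 2 + 3 * (N * (B / w)) + 2 * (N / w) := by ring
  have e5 : 0 < N / w := by positivity
  have e6 : B / w * N = N * (B / w) := mul_comm _ _
  constructor <;> linarith

theorem intervalIntegrable_mul_of_ae_abs_le_one {φ g : ℝ → ℝ} (hφ : Measurable φ)
    (hφ1 : ∀ᵐ t, |φ t| ≤ 1) (hg : Continuous g) (x y : ℝ) :
    IntervalIntegrable (fun t => φ t * g t) volume x y := by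
  refine (hg.intervalIntegrable x y).mono_fun (hφ.mul hg.measurable).aestronglyMeasurable
    (ae_restrict_of_ae ?_)
  filter_upwards [hφ1] with t ht
  simp only [norm_mul]
  exact mul_le_of_le_one_left (norm_nonneg _) ht

/-- The cosine sum with coefficients `b k` at the frequencies `n + k`, `k < m`, and phase `γ`. -/
def shiftedCosSum (b : ℕ → ℝ) (n m : ℕ) (γ t : ℝ) : ℝ :=
  ∑ k ∈ Finset.range m, b k * cos (((n : ℝ) + k) * t + γ)

theorem continuous_shiftedCosSum (b : ℕ → ℝ) (n m : ℕ) (γ : ℝ) :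
    Continuous (shiftedCosSum b n m γ) := by
  unfold shiftedCosSum; fun_prop

theorem shiftedCosSum_eq (b : ℕ → ℝ) (n m : ℕ) (γ t : ℝ) :
    shiftedCosSum b n m γ t = ∑ k ∈ Finset.range m, b k * cos (k * t + (n * t + γ)) := by
  refine Finset.sum_congr rfl fun k _ => ?_
  ring_nf

theorem shiftedCosSum_neg (b : ℕ → ℝ) (n m : ℕ) (γ t : ℝ) :
    shiftedCosSum b n m γ (-t) = shiftedCosSum b n m (-γ) t := by
  refine Finset.sum_congr rfl fun k _ => ?_
  rw [← cos_neg]; ring_nf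

theorem integral_abs_shiftedCosSum_le {b : ℕ → ℝ} (hb : Antitone b) (hb0 : ∀ k, 0 ≤ b k)
    {Q r : ℝ} (h0 : 0 < r) (h1 : r ≤ 1 / 2) (hQ : ∀ k : ℕ, b k ≤ Q * ((k : ℝ) + 1) ^ (-r))
    {x : ℝ} (hx : 0 ≤ x) (hπ : x ≤ π) (n m : ℕ) (γ : ℝ) :
    ∫ t in (0 : ℝ)..x, |shiftedCosSum b n m γ t| ≤ 6 * Q * x ^ r / r := by
  have hb' : ∀ t ∈ Ioc 0 x, ‖shiftedCosSum b n m γ t‖ ≤ 6 * Q * t ^ (r - 1) := fun t ht => by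
    rw [shiftedCosSum_eq]
    exact abs_sum_mul_cos_le_rpow hb hb0 h0 h1 hQ ht.1 (ht.2.trans hπ) _ m
  have h := intervalIntegral.integral_mono_on_of_le_Ioo (μ := volume)
    (f := fun t => |shiftedCosSum b n m γ t|) (g := fun t => 6 * Q * t ^ (r - 1)) hx
    ((continuous_shiftedCosSum b n m γ).abs.intervalIntegrable _ _)
    ((intervalIntegral.intervalIntegrable_rpow' (by linarith)).const_mul _)
    (fun t ht => hb' t ⟨ht.1, ht.2.le⟩)
  refine h.trans (le_of_eq ?_)
  rw [intervalIntegral.integral_const_mul, integral_rpow (Or.inl (by linarith)),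
    sub_add_cancel, zero_rpow h0.ne']
  ring

theorem integral_abs_shiftedCosSum_add_le {b : ℕ → ℝ} (hb : Antitone b) (hb0 : ∀ k, 0 ≤ b k)
    (hconv : Antitone fun k => b k - b (k + 1)) {N : ℝ} (hN : 1 ≤ N) (n m : ℕ) (γ : ℝ) :
    ∫ t in (1 / N)..π, |shiftedCosSum b n m γ t + b 0 * (sin ((n - 1 / 2) * t + γ) / t)| ≤
      4 * b 0 + 8 * N * b m + 5 * N * (b 0 - b 1) := by
  have hN0 : 0 < N := by linarith
  have haπ : 1 / N ≤ π := by
    have : 1 / N ≤ 1 := by rw [div_le_one hN0]; exact hN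
    linarith [pi_gt_three]
  have ha : 0 < 1 / N := by positivity
  have hpos : ∀ t ∈ uIcc (1 / N) π, 0 < t := fun t ht => by
    rw [uIcc_of_le haπ] at ht; exact ha.trans_le ht.1
  have hΔ : 0 ≤ b 0 - b 1 := sub_nonneg.2 (hb zero_le_one)
  have hcinv2 : ContinuousOn (fun t : ℝ => (t ^ 2)⁻¹) (uIcc (1 / N) π) :=
    (continuousOn_id.pow 2).inv₀ fun t ht => pow_ne_zero 2 (hpos t ht).ne'
  have hbound : ∀ t ∈ Icc (1 / N) π,
      |shiftedCosSum b n m γ t + b 0 * (sin ((n - 1 / 2) * t + γ) / t)| ≤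
        (b 0 + 2 * N * b m) + 5 * (b 0 - b 1) * (t ^ 2)⁻¹ := fun t ht => by
    have ht0 : 0 < t := ha.trans_le ht.1
    have hs := sin_half_pos ht0 ht.2
    have hlow := div_pi_le_sin_half ht0 ht.2
    have h1 := abs_sum_mul_cos_add_le hb hb0 hconv hs (n * t + γ) m
    rw [← shiftedCosSum_eq, show n * t + γ - t / 2 = (n - 1 / 2) * t + γ by ring] at h1
    set s := sin ((n - 1 / 2) * t + γ)
    have h2 : |b 0 * s / (2 * sin (t / 2)) - b 0 * (s / t)| ≤ b 0 := by
      have : b 0 * s / (2 * sin (t / 2)) - b 0 * (s / t) =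
          b 0 * (s * (1 / (2 * sin (t / 2)) - 1 / t)) := by ring
      rw [this, abs_mul, abs_mul, abs_of_nonneg (hb0 0)]
      refine mul_le_of_le_one_right (hb0 0) ?_
      exact mul_le_one₀ (abs_sin_le_one _) (abs_nonneg _)
        (abs_inv_two_mul_sin_half_sub_le ht0 ht.2)
    have h3 : b m / (2 * sin (t / 2)) ≤ 2 * N * b m := by
      have hNt : 1 ≤ N * t := by have := ht.1; rwa [div_le_iff₀' hN0] at this
      have hlow' : t ≤ 4 * sin (t / 2) := by
        rw [div_le_iff₀ pi_pos] at hlow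
        nlinarith [pi_lt_four]
      rw [div_le_iff₀ (by positivity)]
      have : 1 ≤ N * (4 * sin (t / 2)) := hNt.trans (by gcongr)
      nlinarith [hb0 m]
    have h4 : (b 0 - b 1) / (2 * sin (t / 2) ^ 2) ≤ 5 * (b 0 - b 1) * (t ^ 2)⁻¹ := by
      have : t ^ 2 ≤ 10 * sin (t / 2) ^ 2 := by
        rw [div_le_iff₀ pi_pos] at hlow
        have hπ2 : π ^ 2 ≤ 10 := by nlinarith [pi_lt_d2, pi_pos]
        calc t ^ 2 ≤ (sin (t / 2) * π) ^ 2 := by gcongr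
          _ = π ^ 2 * sin (t / 2) ^ 2 := by ring
          _ ≤ _ := by gcongr
      rw [← div_eq_mul_inv, div_le_div_iff₀ (by positivity) (by positivity)]
      nlinarith
    calc _ = |(shiftedCosSum b n m γ t + b 0 * s / (2 * sin (t / 2))) -
          (b 0 * s / (2 * sin (t / 2)) - b 0 * (s / t))| := by congr 1; ring
      _ ≤ _ := abs_sub _ _
      _ ≤ _ := by linarith
  have hquot : ContinuousOn (fun t : ℝ => sin ((n - 1 / 2) * t + γ) / t) (uIcc (1 / N) π) :=
    ContinuousOn.div (by fun_prop) continuousOn_id fun t ht => (hpos t ht).ne'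
  have h := intervalIntegral.integral_mono_on (μ := volume) haπ
    (((continuous_shiftedCosSum b n m γ).continuousOn.add
      (continuousOn_const.mul hquot)).abs.intervalIntegrable)
    (intervalIntegrable_const.add (hcinv2.intervalIntegrable.const_mul _)) hbound
  refine h.trans ?_
  rw [intervalIntegral.integral_add (by simp)
    (hcinv2.intervalIntegrable.const_mul _), intervalIntegral.integral_const,
    intervalIntegral.integral_const_mul, smul_eq_mul]
  have h5 : 5 * (b 0 - b 1) * ∫ t in (1 / N)..π, (t ^ 2)⁻¹ ≤ 5 * (b 0 - b 1) * N := by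
    gcongr; exact integral_inv_sq_le hN
  have h6 : (π - 1 / N) * (b 0 + 2 * N * b m) ≤ 4 * (b 0 + 2 * N * b m) := by
    have := hb0 0
    have := hb0 m
    gcongr
    linarith [pi_lt_four]
  linarith

/-- Quantitative regularity of the tail `b` of a coefficient sequence, at the scale `N`. -/
structure RegularTail (b : ℕ → ℝ) (N : ℕ) (K r : ℝ) : Prop where
  antitone : Antitone b
  nonneg : ∀ k, 0 ≤ b k
  convex : Antitone fun k => b k - b (k + 1)
  slope : N * (b 0 - b 1) ≤ K * b 0
  decay : ∀ k : ℕ, b k ≤ 2 * b 0 * (N : ℝ) ^ r * ((k : ℝ) + 1) ^ (-r)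

theorem RegularTail.integral_near_zero_le {b : ℕ → ℝ} {N : ℕ} {K r : ℝ}
    (h : RegularTail b N K r) (hr0 : 0 < r) (hr1 : r ≤ 1 / 2) (hN : 1 ≤ N) (n m : ℕ) (γ : ℝ) :
    ∫ t in (0 : ℝ)..(1 / N), |shiftedCosSum b n m γ t| ≤ 12 / r * b 0 := by
  have hN0 : (0 : ℝ) < N := by exact_mod_cast hN
  have haπ : 1 / (N : ℝ) ≤ π := by
    have : 1 / (N : ℝ) ≤ 1 := by rw [div_le_one hN0]; exact_mod_cast hN
    linarith [pi_gt_three]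
  refine (integral_abs_shiftedCosSum_le h.antitone h.nonneg hr0 hr1 h.decay (by positivity)
    haπ n m γ).trans (le_of_eq ?_)
  rw [one_div, inv_rpow hN0.le]
  have : (N : ℝ) ^ r ≠ 0 := (rpow_pos_of_pos hN0 r).ne'
  field_simp
  ring

theorem exists_integral_shiftedCosSum_bounds {K r : ℝ} (hK : 0 ≤ K) (hr0 : 0 < r)
    (hr1 : r ≤ 1 / 2) (L : ℕ) :
    ∃ C > 0, ∀ (b : ℕ → ℝ) (N n : ℕ), 1 ≤ N → 1 ≤ n → N ≤ L * n → RegularTail b N K r →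
      ∀ (γ : ℝ) (m : ℕ),
        ∫ t in (0 : ℝ)..π, |shiftedCosSum b n m γ t| ≤
          b 0 * (2 / π * log N) + C * b 0 + 8 * N * b m ∧
        ∀ φ : ℝ → ℝ, Measurable φ → (∀ t, |φ t| ≤ 1) →
          (∀ t ∈ Ioo 0 (π / 2),
            φ t * -sin ((n - 1 / 2) * t + γ) = |sin ((n - 1 / 2) * t + γ)|) →
          b 0 * (2 / π * log N) - C * b 0 - 8 * N * b m ≤
            ∫ t in (0 : ℝ)..π, φ t * shiftedCosSum b n m γ t := by
  obtain ⟨C, hC0, hC⟩ := exists_abs_integral_abs_sin_div_sub_log_le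
  refine ⟨12 / r + (4 + 5 * K) + C * (1 + 2 * L) + 4, by positivity,
    fun b N n hN hn hNn hb γ m => ?_⟩
  have hN1 : (1 : ℝ) ≤ N := by exact_mod_cast hN
  have hN0 : (0 : ℝ) < N := by linarith
  have hn1 : (1 : ℝ) ≤ n := by exact_mod_cast hn
  have ha : 0 < 1 / (N : ℝ) := by positivity
  have haπ : 1 / (N : ℝ) ≤ π := by
    have : 1 / (N : ℝ) ≤ 1 := by rw [div_le_one hN0]; exact hN1
    linarith [pi_gt_three]
  have hpos : ∀ t ∈ uIcc (1 / (N : ℝ)) π, 0 < t := fun t ht => by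
    rw [uIcc_of_le haπ] at ht; exact ha.trans_le ht.1
  have hb0 := hb.nonneg 0
  set T := shiftedCosSum b n m γ with hT
  have hTc : Continuous T := continuous_shiftedCosSum b n m γ
  have hnear := hb.integral_near_zero_le hr0 hr1 hN n m γ
  have hfar : ∫ t in (1 / (N : ℝ))..π, |T t + b 0 * (sin ((n - 1 / 2) * t + γ) / t)| ≤
      (4 + 5 * K) * b 0 + 8 * N * b m := by
    refine (integral_abs_shiftedCosSum_add_le hb.antitone hb.nonneg hb.convex hN1 n m γ).trans ?_
    linarith [hb.slope]
  have hmain : |(∫ t in (1 / (N : ℝ))..π, |sin ((n - 1 / 2) * t + γ)| / t) - 2 / π * log N| ≤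
      C * (1 + 2 * L) := by
    refine (hC (n - 1 / 2) (by linarith) γ N hN1).trans ?_
    gcongr
    rw [div_le_iff₀ (by linarith)]
    have : (N : ℝ) ≤ L * n := by exact_mod_cast hNn
    have : (L : ℝ) ≤ L * n := le_mul_of_one_le_right (by positivity) hn1
    linarith
  have hquot : ContinuousOn (fun t : ℝ => sin ((n - 1 / 2) * t + γ) / t) (uIcc (1 / (N : ℝ)) π) :=
    ContinuousOn.div (by fun_prop) continuousOn_id fun t ht => (hpos t ht).ne'
  have habsquot : ContinuousOn (fun t : ℝ => |sin ((n - 1 / 2) * t + γ)| / t)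
      (uIcc (1 / (N : ℝ)) π) :=
    ContinuousOn.div (by fun_prop) continuousOn_id fun t ht => (hpos t ht).ne'
  have hdiff : ContinuousOn (fun t : ℝ => |T t + b 0 * (sin ((n - 1 / 2) * t + γ) / t)|)
      (uIcc (1 / (N : ℝ)) π) := (hTc.continuousOn.add (continuousOn_const.mul hquot)).abs
  have hmul : IntervalIntegrable (fun t => b 0 * (|sin ((n - 1 / 2) * t + γ)| / t)) volume
      (1 / (N : ℝ)) π := habsquot.intervalIntegrable.const_mul _
  have hmain' := mul_le_mul_of_nonneg_left (abs_le.1 hmain).1 hb0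
  have hmain'' := mul_le_mul_of_nonneg_left (abs_le.1 hmain).2 hb0
  constructor
  · rw [← intervalIntegral.integral_add_adjacent_intervals (hTc.abs.intervalIntegrable 0 (1 / N))
      (hTc.abs.intervalIntegrable (1 / N) π)]
    have h1 : ∫ t in (1 / (N : ℝ))..π, |T t| ≤
        ∫ t in (1 / (N : ℝ))..π, (|T t + b 0 * (sin ((n - 1 / 2) * t + γ) / t)| +
          b 0 * (|sin ((n - 1 / 2) * t + γ)| / t)) := by
      refine intervalIntegral.integral_mono_on haπ (hTc.abs.intervalIntegrable _ _)
        (hdiff.intervalIntegrable.add hmul) fun t ht => ?_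
      have ht0 : 0 < t := ha.trans_le ht.1
      have h2 := abs_sub (T t + b 0 * (sin ((n - 1 / 2) * t + γ) / t))
        (b 0 * (sin ((n - 1 / 2) * t + γ) / t))
      rw [add_sub_cancel_right, abs_mul (b 0), abs_div, abs_of_pos ht0, abs_of_nonneg hb0] at h2
      exact h2
    rw [intervalIntegral.integral_add hdiff.intervalIntegrable hmul,
      intervalIntegral.integral_const_mul] at h1
    linarith
  · intro φ hφm hφ1 hφ
    have hint : ∀ x y : ℝ, IntervalIntegrable (fun t => φ t * T t) volume x y := 
      intervalIntegrable_mul_of_ae_abs_le_one hφm (Filter.Eventually.of_forall hφ1) hTc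
    rw [← intervalIntegral.integral_add_adjacent_intervals (hint 0 (1 / N)) (hint (1 / N) π)]
    have hφT : ∀ t x, -|x| ≤ φ t * x := fun t x => by
      have h := neg_abs_le (φ t * x)
      rw [abs_mul] at h
      have := mul_le_of_le_one_left (abs_nonneg x) (hφ1 t)
      linarith
    have h1 : -∫ t in (0 : ℝ)..(1 / N), |T t| ≤ ∫ t in (0 : ℝ)..(1 / N), φ t * T t := by
      rw [← intervalIntegral.integral_neg]
      exact intervalIntegral.integral_mono_on ha.le (hTc.abs.neg.intervalIntegrable _ _)
        (hint _ _) fun t _ => hφT t _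
    have h2 : ∫ t in (1 / (N : ℝ))..π, (b 0 * (|sin ((n - 1 / 2) * t + γ)| / t) - b 0 * (4 / π) -
          |T t + b 0 * (sin ((n - 1 / 2) * t + γ) / t)|) ≤
        ∫ t in (1 / (N : ℝ))..π, φ t * T t := by
      refine intervalIntegral.integral_mono_on haπ
        ((hmul.sub intervalIntegrable_const).sub hdiff.intervalIntegrable)
        (hint _ _) fun t ht => ?_
      have ht0 : 0 < t := ha.trans_le ht.1
      set s := sin ((n - 1 / 2) * t + γ) with hs
      have h3 := hφT t (T t + b 0 * (s / t))
      have h4 : |s| / t - 4 / π ≤ φ t * (-s) / t := by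
        rcases lt_or_ge t (π / 2) with h5 | h5
        · rw [hφ t ⟨ht0, h5⟩]
          have : 0 < 4 / π := by positivity
          linarith
        · have h6 := hφT t (-s)
          rw [abs_neg] at h6
          have h7 : |s| ≤ 1 := abs_sin_le_one _
          have h8 : |s| / t - -|s| / t ≤ 4 / π := by
            rw [← sub_div, div_le_div_iff₀ ht0 pi_pos]
            nlinarith [pi_pos]
          have h9 : -|s| / t ≤ φ t * (-s) / t := by gcongr
          linarith
      have h10 := mul_le_mul_of_nonneg_left h4 hb0
      have h11 : φ t * (T t + b 0 * (s / t)) = φ t * T t - b 0 * (φ t * -s / t) := by ring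
      linarith
    have h12 : ∫ t in (1 / (N : ℝ))..π, b 0 * (4 / π) ≤ 4 * b 0 := by
      rw [intervalIntegral.integral_const, smul_eq_mul]
      calc (π - 1 / N) * (b 0 * (4 / π)) ≤ π * (b 0 * (4 / π)) := by gcongr; linarith
        _ = 4 * b 0 := by field_simp
    rw [intervalIntegral.integral_sub (hmul.sub intervalIntegrable_const)
      hdiff.intervalIntegrable, intervalIntegral.integral_sub hmul intervalIntegrable_const,
      intervalIntegral.integral_const_mul] at h2
    linarith

theorem eq_zero_of_fourier_coeff_eq_zero {g : ℝ → ℝ} (hg : Continuous g) (hper : Periodic2pi g)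
    (hA : ∀ k, fourierA g k = 0) (hB : ∀ k, fourierB g k = 0) (x : ℝ) : g x = 0 := by
  have : Fact (0 < 2 * π) := ⟨by positivity⟩
  have hper' : Function.Periodic (fun x => (g x : ℂ)) (2 * π) := fun x => by simp [hper x]
  let F : C(AddCircle (2 * π), ℂ) := ⟨hper'.lift, by
    refine continuous_coinduced_dom.2 ?_
    exact Complex.continuous_ofReal.comp hg⟩
  have hF : ∀ x : ℝ, F (x : AddCircle (2 * π)) = (g x : ℂ) := fun x => rfl
  have hcos : ∀ n : ℤ, ∫ t in (-π)..π, g t * cos (n * t) = 0 := fun n => by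
    obtain ⟨k, rfl | rfl⟩ := n.eq_nat_or_neg
    · have := hA k
      simpa [fourierA, pi_ne_zero] using this
    · have := hA k
      simpa [fourierA, pi_ne_zero] using this
  have hsin : ∀ n : ℤ, ∫ t in (-π)..π, g t * sin (n * t) = 0 := fun n => by
    obtain ⟨k, rfl | rfl⟩ := n.eq_nat_or_neg
    · have := hB k
      simpa [fourierB, pi_ne_zero] using this
    · have := hB k
      simpa [fourierB, pi_ne_zero] using this
  have hcoeff : fourierCoeff F = 0 := by
    funext n
    rw [fourierCoeff_eq_intervalIntegral F n (-π)]
    have h1 : ∀ t : ℝ, fourier (-n) (t : AddCircle (2 * π)) • F (t : AddCircle (2 * π)) =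
        ((g t * cos (n * t) : ℝ) : ℂ) - Complex.I * ((g t * sin (n * t) : ℝ) : ℂ) := fun t => by
      rw [fourier_coe_apply, hF, smul_eq_mul]
      have : 2 * (π : ℂ) * Complex.I * ((-n : ℤ) : ℂ) * t / ((2 * π : ℝ) : ℂ) =
          ((-(n * t) : ℝ) : ℂ) * Complex.I := by
        push_cast
        have : (π : ℂ) ≠ 0 := by exact_mod_cast pi_ne_zero
        field_simp
      rw [this, Complex.exp_mul_I, ← Complex.ofReal_cos, ← Complex.ofReal_sin, cos_neg, sin_neg]
      push_cast
      ring
    simp_rw [h1]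
    rw [intervalIntegral.integral_sub, intervalIntegral.integral_const_mul,
      intervalIntegral.integral_ofReal, intervalIntegral.integral_ofReal,
      show -π + 2 * π = π by ring, hcos, hsin]
    · simp
    · exact Continuous.intervalIntegrable (by fun_prop) _ _
    · exact Continuous.intervalIntegrable (by fun_prop) _ _
  have hsum : Summable (fourierCoeff F) := by rw [hcoeff]; exact summable_zero
  have h := has_pointwise_sum_fourier_series_of_summable hsum (x : AddCircle (2 * π))
  have h0 : HasSum (fun i : ℤ => fourierCoeff F i • fourier i (x : AddCircle (2 * π))) 0 := by
    simp only [hcoeff, Pi.zero_apply, zero_smul]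
    exact hasSum_zero
  have h2 := h.unique h0
  rw [hF] at h2
  exact_mod_cast h2

/-- The partial sum of order `M` of a trigonometric series with coefficients `p`, `q`. -/
def trigSum (p q : ℕ → ℝ) (M : ℕ) (x : ℝ) : ℝ :=
  ∑ k ∈ Finset.range M, (p k * cos (k * x) + q k * sin (k * x))

theorem continuous_trigSum (p q : ℕ → ℝ) (M : ℕ) : Continuous (trigSum p q M) := by
  unfold trigSum; fun_prop

theorem trigSum_periodic (p q : ℕ → ℝ) (M : ℕ) : Periodic2pi (trigSum p q M) := fun x => by
  refine Finset.sum_congr rfl fun k _ => ?_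
  rw [show (k : ℝ) * (x + 2 * π) = k * x + k * (2 * π) by ring, cos_add_nat_mul_two_pi,
    sin_add_nat_mul_two_pi]

theorem integral_cos_int_mul (m : ℤ) :
    ∫ t in (-π)..π, cos (m * t) = if m = 0 then 2 * π else 0 := by
  split_ifs with h
  · simp [h]; ring
  · have hm : (m : ℝ) ≠ 0 := by exact_mod_cast h
    rw [intervalIntegral.integral_comp_mul_left (fun t => cos t) hm, integral_cos]
    simp

theorem integral_sin_int_mul (m : ℤ) : ∫ t in (-π)..π, sin (m * t) = 0 := by
  by_cases h : m = 0
  · simp [h]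
  · have hm : (m : ℝ) ≠ 0 := by exact_mod_cast h
    rw [intervalIntegral.integral_comp_mul_left (fun t => sin t) hm, integral_sin]
    simp

theorem fourierA_trigSum (p q : ℕ → ℝ) {M k : ℕ} (hk : k < M) :
    fourierA (trigSum p q M) k = (if k = 0 then 2 else 1) * p k := by
  have hterm : ∀ j : ℕ, ∫ t in (-π)..π, (p j * cos (j * t) + q j * sin (j * t)) * cos (k * t) =
      if j = k then π * ((if k = 0 then 2 else 1) * p k) else 0 := fun j => by
    have h1 : ∀ t : ℝ, (p j * cos (j * t) + q j * sin (j * t)) * cos (k * t) =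
        p j / 2 * cos (((j : ℤ) - k : ℤ) * t) + p j / 2 * cos (((j : ℤ) + k : ℤ) * t) +
        (q j / 2 * sin (((j : ℤ) - k : ℤ) * t) + q j / 2 * sin (((j : ℤ) + k : ℤ) * t)) :=
      fun t => by
        push_cast
        rw [show ((j : ℝ) - k) * t = j * t - k * t by ring,
          show ((j : ℝ) + k) * t = j * t + k * t by ring, cos_sub, cos_add, sin_sub, sin_add]
        ring
    simp_rw [h1]
    rw [intervalIntegral.integral_add, intervalIntegral.integral_add,
      intervalIntegral.integral_add]
    · simp only [intervalIntegral.integral_const_mul, integral_cos_int_mul, integral_sin_int_mul]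
      by_cases hjk : j = k
      · subst hjk
        by_cases hj : j = 0
        · simp [hj]; ring
        · have : ¬ ((j : ℤ) + j = 0) := by omega
          simp [hj, this]; ring
      · have h2 : ¬ ((j : ℤ) - k = 0) := by omega
        have h3 : ¬ ((j : ℤ) + k = 0) := by omega
        simp [hjk, h2, h3]
    all_goals exact Continuous.intervalIntegrable (by fun_prop) _ _
  unfold fourierA trigSum
  simp_rw [Finset.sum_mul]
  rw [intervalIntegral.integral_finsetSum
    fun j _ => Continuous.intervalIntegrable (by fun_prop) _ _]
  simp_rw [hterm]
  rw [Finset.sum_ite_eq' _ _ _, if_pos (Finset.mem_range.2 hk)]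
  field_simp

theorem fourierB_trigSum (p q : ℕ → ℝ) {M k : ℕ} (hk : k < M) (hk0 : 1 ≤ k) :
    fourierB (trigSum p q M) k = q k := by
  have hterm : ∀ j : ℕ, ∫ t in (-π)..π, (p j * cos (j * t) + q j * sin (j * t)) * sin (k * t) =
      if j = k then π * q k else 0 := fun j => by
    have h1 : ∀ t : ℝ, (p j * cos (j * t) + q j * sin (j * t)) * sin (k * t) =
        q j / 2 * cos (((j : ℤ) - k : ℤ) * t) + -(q j / 2) * cos (((j : ℤ) + k : ℤ) * t) +
        (-(p j / 2) * sin (((j : ℤ) - k : ℤ) * t) + p j / 2 * sin (((j : ℤ) + k : ℤ) * t)) :=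
      fun t => by
        push_cast
        rw [show ((j : ℝ) - k) * t = j * t - k * t by ring,
          show ((j : ℝ) + k) * t = j * t + k * t by ring, cos_sub, cos_add, sin_sub, sin_add]
        ring
    simp_rw [h1]
    rw [intervalIntegral.integral_add, intervalIntegral.integral_add,
      intervalIntegral.integral_add]
    · simp only [intervalIntegral.integral_const_mul, integral_cos_int_mul, integral_sin_int_mul]
      have h3 : ¬ ((j : ℤ) + k = 0) := by omega
      by_cases hjk : j = k
      · subst hjk
        simp [h3]; ring
      · have h2 : ¬ ((j : ℤ) - k = 0) := by omega
        simp [hjk, h2, h3]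
    all_goals exact Continuous.intervalIntegrable (by fun_prop) _ _
  unfold fourierB trigSum
  simp_rw [Finset.sum_mul]
  rw [intervalIntegral.integral_finsetSum
    fun j _ => Continuous.intervalIntegrable (by fun_prop) _ _]
  simp_rw [hterm]
  rw [Finset.sum_ite_eq' _ _ _, if_pos (Finset.mem_range.2 hk)]
  field_simp

theorem tendsto_integral_mul_of_tendstoUniformly {F : ℕ → ℝ → ℝ} {g h : ℝ → ℝ}
    (hF : ∀ M, Continuous (F M)) (hg : Continuous g) (hFg : TendstoUniformly F g atTop)
    (hh : Continuous h) (hh1 : ∀ t, |h t| ≤ 1) :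
    Tendsto (fun M => ∫ t in (-π)..π, F M t * h t) atTop (nhds (∫ t in (-π)..π, g t * h t)) := by
  rw [Metric.tendsto_atTop]
  intro ε hε
  obtain ⟨M₀, hM₀⟩ := eventually_atTop.1 (Metric.tendstoUniformly_iff.1 hFg (ε / 8) (by positivity))
  refine ⟨M₀, fun M hM => ?_⟩
  have hFM := hF M
  rw [Real.dist_eq, ← intervalIntegral.integral_sub
    (Continuous.intervalIntegrable (by fun_prop) _ _)
    (Continuous.intervalIntegrable (by fun_prop) _ _)]
  have h1 := intervalIntegral.norm_integral_le_of_norm_le_const (a := -π) (b := π)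
    (f := fun t => F M t * h t - g t * h t) (C := ε / 8) (fun t _ => by
      have h2 := hM₀ M hM t
      rw [Real.dist_eq, abs_sub_comm] at h2
      rw [← sub_mul, norm_mul, Real.norm_eq_abs, Real.norm_eq_abs]
      nlinarith [hh1 t, abs_nonneg (F M t - g t), abs_nonneg (h t)])
  rw [Real.norm_eq_abs, show π - -π = 2 * π by ring, abs_of_pos two_pi_pos] at h1
  refine h1.trans_lt ?_
  nlinarith [pi_lt_four, pi_pos]

/-- A trigonometric series with uniformly Cauchy partial sums is the Fourier series of its sum. -/
theorem exists_continuous_of_uniformCauchy_trigSum {p q : ℕ → ℝ}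
    (h : ∀ ε > 0, ∃ n₀, ∀ n ≥ n₀, ∀ m x, |trigSum p q (n + m) x - trigSum p q n x| ≤ ε) :
    ∃ g : ℝ → ℝ, Continuous g ∧ Periodic2pi g ∧
      (∀ x, Tendsto (fun M => trigSum p q M x) atTop (nhds (g x))) ∧
      (∀ k, fourierA g k = (if k = 0 then 2 else 1) * p k) ∧ ∀ k ≥ 1, fourierB g k = q k := by
  have hcauchy : ∀ x, CauchySeq fun M => trigSum p q M x := fun x => by
    rw [Metric.cauchySeq_iff']
    intro ε hε
    obtain ⟨n₀, hn₀⟩ := h (ε / 2) (by positivity)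
    refine ⟨n₀, fun n hn => ?_⟩
    obtain ⟨m, rfl⟩ := Nat.exists_eq_add_of_le hn
    rw [Real.dist_eq]
    linarith [hn₀ n₀ le_rfl m x]
  choose g hg using fun x => cauchySeq_tendsto_of_complete (hcauchy x)
  have hunif : TendstoUniformly (trigSum p q) g atTop := by
    rw [Metric.tendstoUniformly_iff]
    intro ε hε
    obtain ⟨n₀, hn₀⟩ := h (ε / 2) (by positivity)
    filter_upwards [eventually_ge_atTop n₀] with n hn x
    have h1 : Tendsto (fun m => |trigSum p q (m + n) x - trigSum p q n x|) atTop
        (nhds |g x - trigSum p q n x|) :=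
      (((tendsto_add_atTop_iff_nat n).2 (hg x)).sub_const _).abs
    have h2 := le_of_tendsto h1 (Filter.Eventually.of_forall fun m => by
      rw [add_comm m n]; exact hn₀ n hn m x)
    rw [Real.dist_eq]
    linarith
  have hgc : Continuous g :=
    hunif.continuous (Filter.Frequently.of_forall fun M => continuous_trigSum p q M)
  refine ⟨g, hgc, fun x => ?_, hg, fun k => ?_, fun k hk => ?_⟩
  · refine tendsto_nhds_unique (hg (x + 2 * π)) ?_
    simp_rw [trigSum_periodic p q _ x]
    exact hg x
  · refine tendsto_nhds_unique (f := fun M => fourierA (trigSum p q M) k)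
      ((tendsto_integral_mul_of_tendstoUniformly (continuous_trigSum p q) hgc hunif
        (by fun_prop) fun t => abs_cos_le_one _).const_mul _) ?_
    refine tendsto_const_nhds.congr' ?_
    filter_upwards [eventually_gt_atTop k] with M hM
    exact (fourierA_trigSum p q hM).symm
  · refine tendsto_nhds_unique (f := fun M => fourierB (trigSum p q M) k)
      ((tendsto_integral_mul_of_tendstoUniformly (continuous_trigSum p q) hgc hunif
        (by fun_prop) fun t => abs_sin_le_one _).const_mul _) ?_
    refine tendsto_const_nhds.congr' ?_
    filter_upwards [eventually_gt_atTop k] with M hM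
    exact (fourierB_trigSum p q hM hk).symm

theorem fourierSum_eq_trigSum (f : ℝ → ℝ) (M : ℕ) (x : ℝ) :
    FourierSum M f x = trigSum (fun k => if k = 0 then fourierA f 0 / 2 else fourierA f k)
      (fourierB f) M x := by
  refine Finset.sum_congr rfl fun k _ => ?_
  unfold harmonicTerm
  split_ifs with h <;> simp [h]

theorem tendsto_fourierSum_of_uniformCauchy {f : ℝ → ℝ} (hf : Continuous f)
    (hper : Periodic2pi f)
    (h : ∀ ε > 0, ∃ n₀, ∀ n ≥ n₀, ∀ m x, |FourierSum (n + m) f x - FourierSum n f x| ≤ ε) (x : ℝ) :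
    Tendsto (fun M => FourierSum M f x) atTop (nhds (f x)) := by
  simp_rw [fourierSum_eq_trigSum] at h ⊢
  obtain ⟨g, hgc, hgp, hg, hgA, hgB⟩ := exists_continuous_of_uniformCauchy_trigSum h
  have hzero := eq_zero_of_fourier_coeff_eq_zero (g := fun x => f x - g x) (hf.sub hgc)
    (fun x => by simp only [hper x, hgp x]) (fun k => ?_) (fun k => ?_) x
  · rw [sub_eq_zero.1 hzero]; exact hg x
  · have h1 : fourierA (fun x => f x - g x) k = fourierA f k - fourierA g k := by
      unfold fourierA
      rw [← mul_sub, ← intervalIntegral.integral_sub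
        (Continuous.intervalIntegrable (by fun_prop) _ _)
        (Continuous.intervalIntegrable (by fun_prop) _ _)]
      simp_rw [sub_mul]
    rw [h1, hgA]
    split_ifs with hk
    · rw [hk]; ring
    · ring
  · rcases Nat.eq_zero_or_pos k with rfl | hk
    · simp [fourierB]
    · have h1 : fourierB (fun x => f x - g x) k = fourierB f k - fourierB g k := by
        unfold fourierB
        rw [← mul_sub, ← intervalIntegral.integral_sub
          (Continuous.intervalIntegrable (by fun_prop) _ _)
          (Continuous.intervalIntegrable (by fun_prop) _ _)]
        simp_rw [sub_mul]
      rw [h1, hgB k hk, sub_self]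

/-- The cosine coefficients of the function with `(a, β)`-derivative `φ`, where `θ = βπ/2`. -/
def psiCos (a : ℕ → ℝ) (θ : ℝ) (φ : ℝ → ℝ) (k : ℕ) : ℝ :=
  a k * (fourierA φ k * cos θ - fourierB φ k * sin θ)

/-- The sine coefficients of the function with `(a, β)`-derivative `φ`, where `θ = βπ/2`. -/
def psiSin (a : ℕ → ℝ) (θ : ℝ) (φ : ℝ → ℝ) (k : ℕ) : ℝ :=
  a k * (fourierB φ k * cos θ + fourierA φ k * sin θ)

theorem psi_harmonic_eq_integral (a : ℕ → ℝ) (θ : ℝ) {φ : ℝ → ℝ} (hφ : SInf φ) (k : ℕ) (x : ℝ) :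
    psiCos a θ φ k * cos (k * x) + psiSin a θ φ k * sin (k * x) =
      (1 / π) * ∫ u in (-π)..π, φ u * (a k * cos (k * (u - x) + θ)) := by
  have h1 : ∀ u, φ u * (a k * cos (k * (u - x) + θ)) =
      a k * cos (k * x - θ) * (φ u * cos (k * u)) +
        a k * sin (k * x - θ) * (φ u * sin (k * u)) := fun u => by
    rw [show k * (u - x) + θ = k * u - (k * x - θ) by ring, cos_sub (k * u)]
    ring
  simp_rw [h1]
  have hi : ∀ g : ℝ → ℝ, Continuous g →
      IntervalIntegrable (fun t => φ t * g t) volume (-π) π := fun g hg =>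
    intervalIntegrable_mul_of_ae_abs_le_one hφ.1 hφ.2.2 hg _ _
  rw [intervalIntegral.integral_add ((hi _ (by fun_prop)).const_mul _)
    ((hi _ (by fun_prop)).const_mul _), intervalIntegral.integral_const_mul,
    intervalIntegral.integral_const_mul, cos_sub, sin_sub]
  unfold psiCos psiSin fourierA fourierB
  ring

theorem trigSum_psi_sub_eq_integral (a : ℕ → ℝ) (θ : ℝ) {φ : ℝ → ℝ} (hφ : SInf φ) (n m : ℕ)
    (x : ℝ) :
    trigSum (psiCos a θ φ) (psiSin a θ φ) (n + m) x - trigSum (psiCos a θ φ) (psiSin a θ φ) n x =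
      (1 / π) * ∫ u in (-π)..π, φ u * shiftedCosSum (fun k => a (n + k)) n m θ (u - x) := by
  unfold trigSum shiftedCosSum
  rw [Finset.sum_range_add, add_sub_cancel_left]
  simp_rw [psi_harmonic_eq_integral a θ hφ, Finset.mul_sum]
  rw [intervalIntegral.integral_finsetSum fun j _ =>
    intervalIntegrable_mul_of_ae_abs_le_one hφ.1 hφ.2.2 (by fun_prop) _ _, Finset.mul_sum]
  push_cast
  rfl

theorem shiftedCosSum_periodic (b : ℕ → ℝ) (n m : ℕ) (γ : ℝ) :
    Function.Periodic (shiftedCosSum b n m γ) (2 * π) := fun t => by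
  refine Finset.sum_congr rfl fun k _ => ?_
  rw [show ((n : ℝ) + k) * (t + 2 * π) + γ = ((n : ℝ) + k) * t + γ + (n + k : ℕ) * (2 * π) by
    push_cast; ring, cos_add_nat_mul_two_pi]

theorem integral_abs_shiftedCosSum_sub (b : ℕ → ℝ) (n m : ℕ) (γ x : ℝ) :
    ∫ u in (-π)..π, |shiftedCosSum b n m γ (u - x)| =
      (∫ t in (0 : ℝ)..π, |shiftedCosSum b n m γ t|) +
        ∫ t in (0 : ℝ)..π, |shiftedCosSum b n m (-γ) t| := by
  have hc : ∀ γ, Continuous fun t => |shiftedCosSum b n m γ t| := fun γ =>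
    (continuous_shiftedCosSum b n m γ).abs
  have hper : Function.Periodic (fun t => |shiftedCosSum b n m γ t|) (2 * π) := fun t => by
    simp only [shiftedCosSum_periodic b n m γ t]
  rw [intervalIntegral.integral_comp_sub_right (fun t => |shiftedCosSum b n m γ t|),
    show π - x = -π - x + 2 * π by ring, hper.intervalIntegral_add_eq (-π - x) (-π),
    show -π + 2 * π = π by ring,
    ← intervalIntegral.integral_add_adjacent_intervals ((hc γ).intervalIntegrable (-π) 0)
      ((hc γ).intervalIntegrable 0 π), add_comm]
  congr 1
  simp_rw [← shiftedCosSum_neg]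
  rw [intervalIntegral.integral_comp_neg (fun t => |shiftedCosSum b n m γ t|), neg_zero]

theorem abs_trigSum_psi_sub_le (a : ℕ → ℝ) (θ : ℝ) {φ : ℝ → ℝ} (hφ : SInf φ) (n m : ℕ) (x : ℝ) :
    |trigSum (psiCos a θ φ) (psiSin a θ φ) (n + m) x -
        trigSum (psiCos a θ φ) (psiSin a θ φ) n x| ≤
      (1 / π) * ((∫ t in (0 : ℝ)..π, |shiftedCosSum (fun k => a (n + k)) n m θ t|) +
        ∫ t in (0 : ℝ)..π, |shiftedCosSum (fun k => a (n + k)) n m (-θ) t|) := by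
  rw [trigSum_psi_sub_eq_integral a θ hφ, ← integral_abs_shiftedCosSum_sub _ _ _ _ x, abs_mul,
    abs_of_pos (by positivity : 0 < 1 / π)]
  have hc : Continuous fun u => shiftedCosSum (fun k => a (n + k)) n m θ (u - x) :=
    (continuous_shiftedCosSum _ _ _ _).comp (by fun_prop)
  refine mul_le_mul_of_nonneg_left ?_ (by positivity)
  rw [← Real.norm_eq_abs]
  refine intervalIntegral.norm_integral_le_of_norm_le (by linarith [pi_pos]) ?_
    (hc.abs.intervalIntegrable _ _)
  filter_upwards [hφ.2.2] with t ht _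
  rw [Real.norm_eq_abs, abs_mul]
  exact mul_le_of_le_one_left (abs_nonneg _) ht

theorem IsPsiDeriv.fourierA_eq {a : ℕ → ℝ} {β : ℝ} {f φ : ℝ → ℝ} (h : IsPsiDeriv a β f φ) {k : ℕ}
    (hk : 1 ≤ k) (ha : 0 < a k) : fourierA f k = psiCos a (β * π / 2) φ k := by
  obtain ⟨h1, h2⟩ := h.2.2 k hk
  unfold psiCos
  rw [h1, h2]
  field_simp
  linear_combination -fourierA f k * sin_sq_add_cos_sq (β * π / 2)

theorem IsPsiDeriv.fourierB_eq {a : ℕ → ℝ} {β : ℝ} {f φ : ℝ → ℝ} (h : IsPsiDeriv a β f φ) {k : ℕ}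
    (hk : 1 ≤ k) (ha : 0 < a k) : fourierB f k = psiSin a (β * π / 2) φ k := by
  obtain ⟨h1, h2⟩ := h.2.2 k hk
  unfold psiSin
  rw [h1, h2]
  field_simp
  linear_combination -fourierB f k * sin_sq_add_cos_sq (β * π / 2)

theorem IsPsiDeriv.of_coeff_eq {a : ℕ → ℝ} {β : ℝ} {f φ : ℝ → ℝ} (hφ : SInf φ)
    (hφ0 : fourierA φ 0 = 0) (ha : ∀ k ≥ 1, 0 < a k)
    (hA : ∀ k ≥ 1, fourierA f k = psiCos a (β * π / 2) φ k)
    (hB : ∀ k ≥ 1, fourierB f k = psiSin a (β * π / 2) φ k) : IsPsiDeriv a β f φ := by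
  refine ⟨hφ, hφ0, fun k hk => ?_⟩
  have hak := ha k hk
  rw [hA k hk, hB k hk]
  unfold psiCos psiSin
  constructor
  · field_simp
    linear_combination -fourierA φ k * sin_sq_add_cos_sq (β * π / 2)
  · field_simp
    linear_combination -fourierB φ k * sin_sq_add_cos_sq (β * π / 2)

theorem IsPsiDeriv.fourierSum_sub_eq {a : ℕ → ℝ} {β : ℝ} {f φ : ℝ → ℝ} (h : IsPsiDeriv a β f φ)
    (ha : ∀ k ≥ 1, 0 < a k) {n : ℕ} (hn : 1 ≤ n) (m : ℕ) (x : ℝ) :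
    FourierSum (n + m) f x - FourierSum n f x =
      trigSum (psiCos a (β * π / 2) φ) (psiSin a (β * π / 2) φ) (n + m) x -
        trigSum (psiCos a (β * π / 2) φ) (psiSin a (β * π / 2) φ) n x := by
  unfold FourierSum trigSum
  rw [Finset.sum_range_add, Finset.sum_range_add, add_sub_cancel_left, add_sub_cancel_left]
  refine Finset.sum_congr rfl fun k _ => ?_
  have hk : 1 ≤ n + k := by omega
  unfold harmonicTerm
  rw [if_neg (by omega), h.fourierA_eq hk (ha _ hk), h.fourierB_eq hk (ha _ hk)]

/-- A positive null sequence all of whose tails are regular, at scales `N n = O(n)`. -/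
structure RegularSequence (a : ℕ → ℝ) (N : ℕ → ℕ) (K r : ℝ) (L : ℕ) : Prop where
  pos : ∀ k ≥ 1, 0 < a k
  tendsto : Tendsto a atTop (nhds 0)
  tail : ∀ n ≥ 1, RegularTail (fun k => a (n + k)) (N n) K r
  one_le : ∀ n ≥ 1, 1 ≤ N n
  le_mul : ∀ n ≥ 1, N n ≤ L * n

theorem RegularSequence.integral_abs_le {a : ℕ → ℝ} {N : ℕ → ℕ} {K r : ℝ} {L : ℕ}
    (h : RegularSequence a N K r L) (hr0 : 0 < r) (hr1 : r ≤ 1 / 2) {ε : ℝ} (hε : 0 < ε) :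
    ∃ n₀ ≥ 1, ∀ n ≥ n₀, ∀ m γ,
      ∫ t in (0 : ℝ)..π, |shiftedCosSum (fun k => a (n + k)) n m γ t| ≤ ε := by
  have hlim : Tendsto (fun n => 6 * √(a n * (2 * a 1 * (N 1 : ℝ) ^ r)) * π ^ (r / 2) / (r / 2))
      atTop (nhds 0) := by
    have h1 := (((h.tendsto.mul_const (2 * a 1 * (N 1 : ℝ) ^ r)).sqrt.const_mul 6).mul_const
      (π ^ (r / 2))).div_const (r / 2)
    simpa using h1
  obtain ⟨n₁, hn₁⟩ := eventually_atTop.1 (hlim.eventually_le_const hε)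
  refine ⟨max n₁ 1, le_max_right _ _, fun n hn m γ => ?_⟩
  have hn1 : 1 ≤ n := (le_max_right _ _).trans hn
  refine (integral_abs_shiftedCosSum_le (h.tail n hn1).antitone (h.tail n hn1).nonneg
    (Q := √(a n * (2 * a 1 * (N 1 : ℝ) ^ r))) (r := r / 2) (by positivity) (by linarith)
    (fun k => ?_) pi_pos.le le_rfl n m γ).trans (hn₁ n ((le_max_left _ _).trans hn))
  have ha1 := (h.pos 1 le_rfl).le
  have h0 : 0 ≤ a (n + k) := (h.tail n hn1).nonneg k
  have h1 : a (n + k) ≤ a n := (h.tail n hn1).antitone (Nat.zero_le k)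
  have h2 : a (n + k) ≤ 2 * a 1 * (N 1 : ℝ) ^ r * ((k : ℝ) + 1) ^ (-r) := by
    refine le_trans ?_ ((h.tail 1 le_rfl).decay k)
    obtain ⟨j, rfl⟩ := Nat.exists_eq_add_of_le hn1
    have := (h.tail 1 le_rfl).antitone (Nat.le_add_left k j)
    simpa [add_assoc] using this
  have h3 : ((k : ℝ) + 1) ^ (-(r / 2)) = √(((k : ℝ) + 1) ^ (-r)) := by
    rw [sqrt_eq_rpow, ← rpow_mul (by positivity)]
    ring_nf
  have h4 : 0 ≤ a n * (2 * a 1 * (N 1 : ℝ) ^ r) :=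
    mul_nonneg (h0.trans h1) (mul_nonneg (by linarith) (by positivity))
  rw [h3, ← sqrt_mul h4]
  refine le_sqrt_of_sq_le ?_
  rw [sq, mul_assoc]
  exact mul_le_mul h1 h2 h0 (h0.trans h1)

theorem RegularSequence.abs_trigSum_psi_sub_le {a : ℕ → ℝ} {N : ℕ → ℕ} {K r : ℝ} {L : ℕ}
    (h : RegularSequence a N K r L) (hr0 : 0 < r) (hr1 : r ≤ 1 / 2) (θ : ℝ) {φ : ℝ → ℝ}
    (hφ : SInf φ) {ε : ℝ} (hε : 0 < ε) :
    ∃ n₀ ≥ 1, ∀ n ≥ n₀, ∀ m x,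
      |trigSum (psiCos a θ φ) (psiSin a θ φ) (n + m) x -
        trigSum (psiCos a θ φ) (psiSin a θ φ) n x| ≤ ε := by
  obtain ⟨n₀, hn₀, H⟩ := h.integral_abs_le hr0 hr1 hε
  refine ⟨n₀, hn₀, fun n hn m x => (_root_.abs_trigSum_psi_sub_le a θ hφ n m x).trans ?_⟩
  have h1 := H n hn m θ
  have h2 := H n hn m (-θ)
  rw [one_div, inv_mul_le_iff₀ pi_pos]
  nlinarith [pi_gt_three]

theorem RegularSequence.tendsto_fourierSum {a : ℕ → ℝ} {N : ℕ → ℕ} {K r : ℝ} {L : ℕ}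
    (h : RegularSequence a N K r L) (hr0 : 0 < r) (hr1 : r ≤ 1 / 2) {β : ℝ} {f : ℝ → ℝ}
    (hf : ClassC a β f) (x : ℝ) : Tendsto (fun M => FourierSum M f x) atTop (nhds (f x)) := by
  obtain ⟨hc, hper, φ, hφ⟩ := hf
  refine tendsto_fourierSum_of_uniformCauchy hc hper (fun ε hε => ?_) x
  obtain ⟨n₀, hn₀, H⟩ := h.abs_trigSum_psi_sub_le hr0 hr1 (β * π / 2) hφ.1 hε
  refine ⟨n₀, fun n hn m x => ?_⟩
  rw [hφ.fourierSum_sub_eq h.pos (hn₀.trans hn)]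
  exact H n hn m x

theorem RegularSequence.exists_psi_integral {a : ℕ → ℝ} {N : ℕ → ℕ} {K r : ℝ} {L : ℕ}
    (h : RegularSequence a N K r L) (hr0 : 0 < r) (hr1 : r ≤ 1 / 2) (β : ℝ) {φ : ℝ → ℝ}
    (hφ : SInf φ) (hφ0 : fourierA φ 0 = 0) :
    ∃ f, Continuous f ∧ Periodic2pi f ∧ IsPsiDeriv a β f φ := by
  obtain ⟨f, hfc, hfp, -, hA, hB⟩ := exists_continuous_of_uniformCauchy_trigSum
    (p := psiCos a (β * π / 2) φ) (q := psiSin a (β * π / 2) φ) fun ε hε => by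
      obtain ⟨n₀, -, H⟩ := h.abs_trigSum_psi_sub_le hr0 hr1 (β * π / 2) hφ hε
      exact ⟨n₀, H⟩
  refine ⟨f, hfc, hfp, IsPsiDeriv.of_coeff_eq hφ hφ0 h.pos (fun k hk => ?_) hB⟩
  rw [hA k, if_neg (by omega), one_mul]

/-- The sign of the difference of two consecutive shifted cosines, restricted to `cos t > 0`. -/
def cosDiffSign (n : ℕ) (γ t : ℝ) : ℝ :=
  if 0 < cos t then
    if 0 < cos (n * t + γ) - cos (((n : ℝ) - 1) * t + γ) then 1 else -1
  else 0

theorem measurable_cosDiffSign (n : ℕ) (γ : ℝ) : Measurable (cosDiffSign n γ) := by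
  unfold cosDiffSign
  refine Measurable.ite (measurableSet_lt measurable_const (by fun_prop)) ?_ measurable_const
  exact Measurable.ite (measurableSet_lt measurable_const (by fun_prop)) measurable_const
    measurable_const

theorem cosDiffSign_periodic (n : ℕ) (γ : ℝ) : Function.Periodic (cosDiffSign n γ) (2 * π) :=
  fun t => by
    unfold cosDiffSign
    rw [cos_add_two_pi, show (n : ℝ) * (t + 2 * π) + γ = n * t + γ + (n : ℤ) * (2 * π) by
      push_cast; ring, show ((n : ℝ) - 1) * (t + 2 * π) + γ =
        ((n : ℝ) - 1) * t + γ + ((n : ℤ) - 1 : ℤ) * (2 * π) by push_cast; ring,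
      cos_add_int_mul_two_pi, cos_add_int_mul_two_pi]

theorem cosDiffSign_neg (n : ℕ) (γ t : ℝ) : cosDiffSign n γ (-t) = cosDiffSign n (-γ) t := by
  unfold cosDiffSign
  rw [cos_neg, ← cos_neg (n * -t + γ), ← cos_neg (((n : ℝ) - 1) * -t + γ)]
  ring_nf

theorem abs_cosDiffSign_le (n : ℕ) (γ t : ℝ) : |cosDiffSign n γ t| ≤ 1 := by
  unfold cosDiffSign; split_ifs <;> simp

theorem cosDiffSign_of_cos_nonpos (n : ℕ) (γ : ℝ) {t : ℝ} (ht : cos t ≤ 0) :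
    cosDiffSign n γ t = 0 := if_neg ht.not_gt

/-- The antiperiodic extension of `cosDiffSign`, a nearly extremal derivative. -/
def extremalSign (n : ℕ) (γ t : ℝ) : ℝ := cosDiffSign n γ t - cosDiffSign n γ (t + π)

theorem abs_extremalSign_le (n : ℕ) (γ t : ℝ) : |extremalSign n γ t| ≤ 1 := by
  unfold extremalSign
  rcases le_total (cos t) 0 with h | h
  · rw [cosDiffSign_of_cos_nonpos n γ h, zero_sub, abs_neg]
    exact abs_cosDiffSign_le _ _ _
  · rw [cosDiffSign_of_cos_nonpos n γ (t := t + π) (by rw [cos_add_pi]; linarith), sub_zero]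
    exact abs_cosDiffSign_le _ _ _

theorem measurable_extremalSign (n : ℕ) (γ : ℝ) : Measurable (extremalSign n γ) :=
  (measurable_cosDiffSign n γ).sub ((measurable_cosDiffSign n γ).comp (measurable_add_const π))

theorem sInf_extremalSign (n : ℕ) (γ : ℝ) : SInf (extremalSign n γ) := by
  refine ⟨measurable_extremalSign n γ, fun t => ?_,
    Filter.Eventually.of_forall (abs_extremalSign_le n γ)⟩
  unfold extremalSign
  rw [cosDiffSign_periodic n γ t, show t + 2 * π + π = t + π + 2 * π by ring,
    cosDiffSign_periodic n γ (t + π)]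

theorem extremalSign_neg (n : ℕ) (γ t : ℝ) : extremalSign n γ (-t) = extremalSign n (-γ) t := by
  unfold extremalSign
  rw [cosDiffSign_neg, show -t + π = -(t - π) by ring, cosDiffSign_neg,
    ← cosDiffSign_periodic n (-γ) (t - π)]
  ring_nf

theorem fourierA_extremalSign_zero (n : ℕ) (γ : ℝ) : fourierA (extremalSign n γ) 0 = 0 := by
  have hi : ∀ x y, IntervalIntegrable (cosDiffSign n γ) volume x y := fun x y => by
    simpa using intervalIntegrable_mul_of_ae_abs_le_one (measurable_cosDiffSign n γ)
      (Filter.Eventually.of_forall (abs_cosDiffSign_le n γ)) (g := fun _ => 1) continuous_const x y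
  unfold fourierA extremalSign
  simp only [Nat.cast_zero, zero_mul, cos_zero, mul_one]
  rw [intervalIntegral.integral_sub (hi _ _) (by simpa using (hi (-π + π) (π + π)).comp_add_right π),
    intervalIntegral.integral_comp_add_right (cosDiffSign n γ),
    show π + π = -π + π + 2 * π by ring,
    (cosDiffSign_periodic n γ).intervalIntegral_add_eq (-π + π) (-π),
    show -π + 2 * π = π by ring, sub_self, mul_zero]

theorem extremalSign_mul_neg_sin (n : ℕ) (γ : ℝ) {t : ℝ} (ht : t ∈ Ioo 0 (π / 2)) :
    extremalSign n γ t * -sin ((n - 1 / 2) * t + γ) = |sin ((n - 1 / 2) * t + γ)| := by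
  have hcos : 0 < cos t := cos_pos_of_mem_Ioo ⟨by linarith [ht.1, pi_pos], ht.2⟩
  have hsin : 0 < sin (t / 2) := sin_pos_of_pos_of_lt_pi (by linarith [ht.1])
    (by linarith [ht.2, pi_pos])
  have hd : cos (n * t + γ) - cos (((n : ℝ) - 1) * t + γ) =
      -2 * sin ((n - 1 / 2) * t + γ) * sin (t / 2) := by
    rw [cos_sub_cos]
    ring_nf
  unfold extremalSign
  rw [cosDiffSign_of_cos_nonpos n γ (t := t + π) (by rw [cos_add_pi]; linarith), sub_zero]
  unfold cosDiffSign
  rw [if_pos hcos, hd]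
  split_ifs with hs
  · rw [abs_of_nonpos, one_mul]
    by_contra! hneg
    nlinarith [mul_pos hneg hsin]
  · rw [abs_of_nonneg]
    · ring
    · by_contra! hneg
      nlinarith [mul_pos_of_neg_of_neg hneg (neg_lt_zero.2 hsin)]

theorem integral_extremalSign_mul (b : ℕ → ℝ) (n m : ℕ) (γ : ℝ) :
    ∫ t in (-π)..π, extremalSign n γ t * shiftedCosSum b n m γ t =
      (∫ t in (0 : ℝ)..π, extremalSign n γ t * shiftedCosSum b n m γ t) +
        ∫ t in (0 : ℝ)..π, extremalSign n (-γ) t * shiftedCosSum b n m (-γ) t := by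
  have hi : ∀ x y, IntervalIntegrable (fun t => extremalSign n γ t * shiftedCosSum b n m γ t)
      volume x y := fun x y => intervalIntegrable_mul_of_ae_abs_le_one (measurable_extremalSign n γ)
        (Filter.Eventually.of_forall (abs_extremalSign_le n γ)) (continuous_shiftedCosSum b n m γ) x y
  rw [← intervalIntegral.integral_add_adjacent_intervals (hi (-π) 0) (hi 0 π), add_comm]
  congr 1
  simp_rw [← shiftedCosSum_neg, ← extremalSign_neg]
  rw [intervalIntegral.integral_comp_neg
    (fun t => extremalSign n γ t * shiftedCosSum b n m γ t), neg_zero]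

/-- Asymptotics of the supremum of the deviations of Fourier sums, for regular sequences. -/
theorem RegularSequence.exists_abs_classSup_sub_le {a : ℕ → ℝ} {N : ℕ → ℕ} {K r : ℝ} {L : ℕ}
    (h : RegularSequence a N K r L) (hK : 0 ≤ K) (hr0 : 0 < r) (hr1 : r ≤ 1 / 2) :
    ∃ C > 0, ∀ (β : ℝ) (n : ℕ), 1 ≤ n →
      |classSup a β (FourierSum n) - 4 / π ^ 2 * a n * log (N n)| ≤ C * a n := by
  obtain ⟨C, hC0, hC⟩ := exists_integral_shiftedCosSum_bounds hK hr0 hr1 L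
  refine ⟨2 / π * C, by positivity, fun β n hn => ?_⟩
  have hb := fun γ m => hC (fun k => a (n + k)) (N n) n (h.one_le n hn) hn (h.le_mul n hn)
    (h.tail n hn) γ m
  simp only [add_zero] at hb
  have han := h.pos n hn
  have hN1 : (1 : ℝ) ≤ N n := by exact_mod_cast h.one_le n hn
  have hlog := log_nonneg hN1
  have hlim : Tendsto (fun m => 8 * (N n : ℝ) * a (n + m)) atTop (nhds 0) := by
    have h1 : Tendsto (fun m => a (n + m)) atTop (nhds 0) :=
      h.tendsto.comp (tendsto_add_atTop_nat n |>.congr fun m => add_comm m n)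
    simpa using h1.const_mul (8 * (N n : ℝ))
  have hupper : ∀ f, ClassC a β f → ∀ x, |f x - FourierSum n f x| ≤
      4 / π ^ 2 * a n * log (N n) + 2 / π * C * a n := fun f hf x => by
    have hf' := hf
    obtain ⟨-, -, φ, hφ⟩ := hf'
    have h1 : Tendsto (fun m => |FourierSum (n + m) f x - FourierSum n f x|) atTop
        (nhds |f x - FourierSum n f x|) :=
      (((h.tendsto_fourierSum hr0 hr1 hf x).comp
        (tendsto_add_atTop_nat n |>.congr fun m => add_comm m n)).sub_const _).abs
    have h2 : Tendsto (fun m => 4 / π ^ 2 * a n * log (N n) + 2 / π * C * a n +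
        2 / π * (8 * (N n : ℝ) * a (n + m))) atTop
        (nhds (4 / π ^ 2 * a n * log (N n) + 2 / π * C * a n)) := by
      simpa using (hlim.const_mul (2 / π)).const_add
        (4 / π ^ 2 * a n * log (N n) + 2 / π * C * a n)
    refine le_of_tendsto_of_tendsto' h1 h2 fun m => ?_
    rw [hφ.fourierSum_sub_eq h.pos hn]
    refine (_root_.abs_trigSum_psi_sub_le a _ hφ.1 n m x).trans ?_
    have h3 := add_le_add (hb (β * π / 2) m).1 (hb (-(β * π / 2)) m).1
    refine (mul_le_mul_of_nonneg_left h3 (by positivity)).trans_eq ?_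
    field_simp
    ring
  have hnonneg : 0 ≤ 4 / π ^ 2 * a n * log (N n) + 2 / π * C * a n := by positivity
  have hle : ∀ e ∈ {e | ∃ f, ClassC a β f ∧ e = ⨆ x : ℝ, |f x - FourierSum n f x|},
      e ≤ 4 / π ^ 2 * a n * log (N n) + 2 / π * C * a n := by
    rintro e ⟨f, hf, rfl⟩
    exact Real.iSup_le (hupper f hf) hnonneg
  rw [abs_le]
  constructor
  · set γ := β * π / 2 with hγ
    obtain ⟨f, hfc, hfp, hfφ⟩ := h.exists_psi_integral hr0 hr1 β (sInf_extremalSign n γ)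
      (fourierA_extremalSign_zero n γ)
    have hf : ClassC a β f := ⟨hfc, hfp, _, hfφ⟩
    have h1 : Tendsto (fun m => FourierSum (n + m) f 0 - FourierSum n f 0) atTop
        (nhds (f 0 - FourierSum n f 0)) :=
      ((h.tendsto_fourierSum hr0 hr1 hf 0).comp
        (tendsto_add_atTop_nat n |>.congr fun m => add_comm m n)).sub_const _
    have h2 : Tendsto (fun m => 4 / π ^ 2 * a n * log (N n) - 2 / π * C * a n -
        2 / π * (8 * (N n : ℝ) * a (n + m))) atTop
        (nhds (4 / π ^ 2 * a n * log (N n) - 2 / π * C * a n)) := by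
      simpa using (hlim.const_mul (2 / π)).const_sub
        (4 / π ^ 2 * a n * log (N n) - 2 / π * C * a n)
    have h3 : 4 / π ^ 2 * a n * log (N n) - 2 / π * C * a n ≤ f 0 - FourierSum n f 0 := by
      refine le_of_tendsto_of_tendsto' h2 h1 fun m => ?_
      rw [hfφ.fourierSum_sub_eq h.pos hn, trigSum_psi_sub_eq_integral a _ (sInf_extremalSign n γ)]
      simp only [sub_zero]
      rw [← hγ, integral_extremalSign_mul]
      have h4 := fun δ => (hb δ m).2 (extremalSign n δ) (measurable_extremalSign n δ)
        (abs_extremalSign_le n δ) fun t ht => extremalSign_mul_neg_sin n δ ht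
      refine le_trans (le_of_eq ?_)
        (mul_le_mul_of_nonneg_left (add_le_add (h4 γ) (h4 (-γ))) (by positivity))
      field_simp
      ring
    have h5 : |f 0 - FourierSum n f 0| ≤ ⨆ x : ℝ, |f x - FourierSum n f x| :=
      le_ciSup (f := fun x : ℝ => |f x - FourierSum n f x|)
        ⟨_, by rintro _ ⟨x, rfl⟩; exact hupper f hf x⟩ 0
    have h6 : (⨆ x : ℝ, |f x - FourierSum n f x|) ≤ classSup a β (FourierSum n) :=
      le_csSup ⟨_, hle⟩ ⟨f, hf, rfl⟩
    linarith [le_abs_self (f 0 - FourierSum n f 0)]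
  · have : classSup a β (FourierSum n) ≤ 4 / π ^ 2 * a n * log (N n) + 2 / π * C * a n :=
      Real.sSup_le hle hnonneg
    linarith

theorem MClass.strictAntiOn {ψ : ℝ → ℝ} (h : MClass ψ) : StrictAntiOn ψ (Ici 1) := by
  intro x hx y hy hxy
  by_contra! hle
  have hev : ∀ z > y, ψ y ≤ ψ z := fun z hz => by
    have h1 := h.2.1.slope_mono_adjacent hx (le_trans hy hz.le : (1 : ℝ) ≤ z) hxy hz
    have h2 : 0 ≤ (ψ z - ψ y) / (z - y) :=
      le_trans (div_nonneg (by linarith) (by linarith)) h1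
    by_contra! hzy
    linarith [div_neg_of_neg_of_pos (sub_neg.2 hzy) (sub_pos.2 hz)]
  have h1 := ge_of_tendsto h.2.2 ((eventually_gt_atTop y).mono hev)
  linarith [h.1 y hy]

theorem MClass.eta_spec {ψ : ℝ → ℝ} (h : MClass ψ) {t : ℝ} (ht : 1 < t) :
    t < eta ψ t ∧ ψ (eta ψ t) = ψ t / 2 := by
  have hpos := h.1 t ht.le
  obtain ⟨z, hz, hzt⟩ := ((h.2.2.eventually_lt_const (half_pos hpos)).and
    (eventually_gt_atTop t)).exists
  have hcont : ContinuousOn ψ (Icc t z) :=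
    h.2.1.continuousOn_interior.mono fun x hx => by
      rw [interior_Ici]
      exact ht.trans_le hx.1
  obtain ⟨y, hy, hyt⟩ := intermediate_value_Icc' hzt.le hcont
    (show ψ t / 2 ∈ Icc (ψ z) (ψ t) from ⟨hz.le, by linarith⟩)
  have hex : ∃ y ∈ Ici (1 : ℝ), ψ y = ψ t / 2 := ⟨y, ht.le.trans hy.1, hyt⟩
  have hval : ψ (eta ψ t) = ψ t / 2 := Function.invFunOn_eq hex
  have hmem : eta ψ t ∈ Ici (1 : ℝ) := Function.invFunOn_mem hex
  refine ⟨?_, hval⟩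
  rw [← h.strictAntiOn.lt_iff_gt hmem ht.le, hval]
  linarith

theorem FClass.exists_eta_sub_le {ψ : ℝ → ℝ} (h : FClass ψ) :
    ∃ K ≥ (0 : ℝ), ∀ s t, 1 ≤ s → s ≤ t → eta ψ t - eta ψ s ≤ K * (t - s) := by
  obtain ⟨-, K, hK⟩ := h
  refine ⟨max K 0, le_max_right _ _, fun s t hs hst => ?_⟩
  refine (convex_Ici (1 : ℝ)).image_sub_le_mul_sub_of_deriv_le
    (fun x hx => (hK x hx).1.continuousAt.continuousWithinAt)
    (fun x hx => (hK x (interior_subset hx)).1.differentiableWithinAt)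
    (fun x hx => (hK x (interior_subset hx)).2.trans (le_max_left _ _)) s hs t (hs.trans hst) hst

/-- The distance `η(ψ;n) - n`, rounded up to a positive integer. -/
def etaGap (ψ : ℝ → ℝ) (n : ℕ) : ℕ := ⌈max (eta ψ n - n) 1⌉₊

theorem le_etaGap (ψ : ℝ → ℝ) (n : ℕ) : max (eta ψ n - n) 1 ≤ etaGap ψ n := Nat.le_ceil _

theorem etaGap_le (ψ : ℝ → ℝ) (n : ℕ) : (etaGap ψ n : ℝ) ≤ 2 * max (eta ψ n - n) 1 := by
  have h1 := Nat.ceil_lt_add_one (show 0 ≤ max (eta ψ n - n) 1 by positivity)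
  have h2 := le_max_right (eta ψ n - n) 1
  unfold etaGap
  linarith

theorem one_le_etaGap (ψ : ℝ → ℝ) (n : ℕ) : 1 ≤ etaGap ψ n := by
  exact_mod_cast (le_max_right _ _).trans (le_etaGap ψ n)

theorem MClass.apply_mul_le {ψ : ℝ → ℝ} (h : MClass ψ) {K : ℝ}
    (hK : ∀ s t, 1 ≤ s → s ≤ t → eta ψ t - eta ψ s ≤ K * (t - s)) {L : ℕ} (hL : K + 1 ≤ L)
    {n s : ℕ} (hn : 1 ≤ n) (hs : etaGap ψ n ≤ s) :
    ψ (n + (L * s : ℕ)) ≤ ψ (n + s) / 2 := by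
  have hn1 : (1 : ℝ) ≤ n := by exact_mod_cast hn
  have hs1 : (1 : ℝ) ≤ s := by exact_mod_cast (one_le_etaGap ψ n).trans hs
  have hs' : (etaGap ψ n : ℝ) ≤ s := by exact_mod_cast hs
  have h1 := hK n (n + s) hn1 (by linarith)
  have h2 := (le_max_left _ _).trans (le_etaGap ψ n)
  obtain ⟨h3, h4⟩ := h.eta_spec (show (1 : ℝ) < n + s by linarith)
  rw [← h4]
  have h5 : eta ψ (n + s) ≤ n + (L * s : ℕ) := by
    push_cast
    nlinarith
  exact h.strictAntiOn.antitoneOn (show (1 : ℝ) ≤ _ by linarith) (show (1 : ℝ) ≤ _ by linarith) h5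

theorem MClass.apply_etaGap_mul_pow_le {ψ : ℝ → ℝ} (h : MClass ψ) {K : ℝ}
    (hK : ∀ s t, 1 ≤ s → s ≤ t → eta ψ t - eta ψ s ≤ K * (t - s)) {L : ℕ} (hL : K + 1 ≤ L)
    (hL1 : 1 ≤ L) {n : ℕ} (hn : 1 ≤ n) (j : ℕ) :
    ψ (n + (etaGap ψ n * L ^ j : ℕ)) ≤ ψ n / 2 ^ j := by
  have hn1 : (1 : ℝ) ≤ n := by exact_mod_cast hn
  induction j with
  | zero =>
    rw [pow_zero, pow_zero, div_one]
    exact h.strictAntiOn.antitoneOn hn1 (show (1 : ℝ) ≤ n + (etaGap ψ n * 1 : ℕ) by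
      linarith [(Nat.cast_nonneg _ : (0 : ℝ) ≤ (etaGap ψ n * 1 : ℕ))]) (by simp)
  | succ j ih =>
    have h1 := h.apply_mul_le hK hL hn (s := etaGap ψ n * L ^ j)
      (Nat.le_mul_of_pos_right _ (by positivity))
    rw [show L * (etaGap ψ n * L ^ j) = etaGap ψ n * L ^ (j + 1) by ring] at h1
    refine h1.trans ?_
    rw [pow_succ, ← div_div]
    linarith

theorem MClass.decay {ψ : ℝ → ℝ} (h : MClass ψ) {K : ℝ}
    (hK : ∀ s t, 1 ≤ s → s ≤ t → eta ψ t - eta ψ s ≤ K * (t - s)) {L : ℕ} (hL : K + 1 ≤ L)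
    (hL1 : 2 ≤ L) {r : ℝ} (hr : 0 < r) (hLr : (L : ℝ) ^ r = 2) {n : ℕ} (hn : 1 ≤ n) (k : ℕ) :
    ψ (n + k) ≤ 2 * ψ n * (etaGap ψ n : ℝ) ^ r * ((k : ℝ) + 1) ^ (-r) := by
  have hn1 : (1 : ℝ) ≤ n := by exact_mod_cast hn
  have hψ := h.1 n hn1
  have hN := one_le_etaGap ψ n
  have hanti := h.strictAntiOn.antitoneOn
  rw [rpow_neg (by positivity), ← div_eq_mul_inv, le_div_iff₀ (by positivity)]
  rcases lt_or_ge k (etaGap ψ n) with hk | hk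
  · have h1 : ψ (n + k) ≤ ψ n := hanti hn1 (show (1 : ℝ) ≤ n + k by
      linarith [(Nat.cast_nonneg k : (0 : ℝ) ≤ k)]) (by simp)
    have h2 : ((k : ℝ) + 1) ^ r ≤ (etaGap ψ n : ℝ) ^ r :=
      rpow_le_rpow (by positivity) (by exact_mod_cast hk) hr.le
    have h3 := mul_le_mul h1 h2 (by positivity) hψ.le
    nlinarith [show 0 ≤ ψ n * (etaGap ψ n : ℝ) ^ r by positivity]
  · set q := k / etaGap ψ n with hq
    set j := Nat.log L q with hj
    have hq0 : q ≠ 0 := (Nat.div_pos hk (by omega)).ne'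
    have h1 : etaGap ψ n * L ^ j ≤ k :=
      (Nat.mul_le_mul_left _ (Nat.pow_log_le_self L hq0)).trans (Nat.mul_div_le k _)
    have h2 : k + 1 ≤ etaGap ψ n * L ^ (j + 1) := by
      have h3 : q + 1 ≤ L ^ (j + 1) := Nat.lt_pow_succ_log_self (by omega) q
      have h4 : k < etaGap ψ n * (q + 1) := Nat.lt_mul_div_succ k (by omega)
      exact h4.trans_le (Nat.mul_le_mul_left _ h3)
    have h1' : ((etaGap ψ n * L ^ j : ℕ) : ℝ) ≤ k := by exact_mod_cast h1
    have h2' : (k : ℝ) + 1 ≤ etaGap ψ n * (L : ℝ) ^ (j + 1) := by exact_mod_cast h2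
    have h5 : ψ (n + k) ≤ ψ n / 2 ^ j :=
      (hanti (show (1 : ℝ) ≤ n + (etaGap ψ n * L ^ j : ℕ) by
          linarith [(Nat.cast_nonneg _ : (0 : ℝ) ≤ (etaGap ψ n * L ^ j : ℕ))])
        (show (1 : ℝ) ≤ n + k by linarith [(Nat.cast_nonneg k : (0 : ℝ) ≤ k)])
        (by linarith)).trans (h.apply_etaGap_mul_pow_le hK hL (by omega) hn j)
    have h6 : ((k : ℝ) + 1) ^ r ≤ (etaGap ψ n : ℝ) ^ r * 2 ^ (j + 1) := by
      refine (rpow_le_rpow (by positivity) h2' hr.le).trans_eq ?_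
      rw [mul_rpow (by positivity) (by positivity), ← rpow_natCast, ← rpow_mul (by positivity),
        mul_comm ((j + 1 : ℕ) : ℝ), rpow_mul (by positivity), hLr, rpow_natCast]
    refine (mul_le_mul h5 h6 (by positivity) (by positivity)).trans_eq ?_
    rw [pow_succ]
    field_simp

theorem MClass.etaGap_mul_sub_le {ψ : ℝ → ℝ} (h : MClass ψ) {K : ℝ} (hK0 : 0 ≤ K)
    (hK : ∀ s t, 1 ≤ s → s ≤ t → eta ψ t - eta ψ s ≤ K * (t - s)) {n : ℕ} (hn : 1 ≤ n) :
    etaGap ψ n * (ψ n - ψ (n + 1)) ≤ (2 * K + etaGap ψ 1) * ψ n := by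
  have hn1 : (1 : ℝ) ≤ n := by exact_mod_cast hn
  have hψ := h.1 n hn1
  have hψ1 := h.1 (n + 1) (by linarith)
  have hN1 : (1 : ℝ) ≤ etaGap ψ 1 := by exact_mod_cast one_le_etaGap ψ 1
  have hΔ : ψ n - ψ (n + 1) ≤ ψ n := by linarith
  have hKψ := mul_nonneg hK0 hψ.le
  rcases hn.eq_or_lt with rfl | hn2
  · push_cast at *
    nlinarith
  have hn2' : (1 : ℝ) < n := by exact_mod_cast hn2
  rcases lt_or_ge (eta ψ n - n) 1 with hm | hm
  · have : etaGap ψ n = 1 := by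
      unfold etaGap
      rw [max_eq_right hm.le, Nat.ceil_one]
    rw [this]
    push_cast
    nlinarith
  · obtain ⟨h1, h2⟩ := h.eta_spec hn2'
    obtain ⟨h3, h4⟩ := h.eta_spec (show (1 : ℝ) < n + 1 by linarith)
    have hlt : ψ (n + 1) < ψ n := h.strictAntiOn hn1 (show (1 : ℝ) ≤ n + 1 by linarith) (by linarith)
    have hyz : eta ψ n < eta ψ (n + 1) := by
      rw [← h.strictAntiOn.lt_iff_gt (show (1 : ℝ) ≤ _ by linarith) (show (1 : ℝ) ≤ _ by linarith)]
      linarith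
    have h5 := h.2.1.slope_mono_adjacent hn1 (show (1 : ℝ) ≤ eta ψ (n + 1) by linarith) h1 hyz
    rw [div_le_div_iff₀ (by linarith) (by linarith), h2, h4] at h5
    have h6 := hK n (n + 1) hn1 (by linarith)
    have h7 := etaGap_le ψ n
    rw [max_eq_left hm] at h7
    have h8 : (ψ n - ψ (n + 1)) * (eta ψ n - n) ≤ K * ψ n := by nlinarith
    have h9 : (etaGap ψ n : ℝ) * (ψ n - ψ (n + 1)) ≤
        2 * (eta ψ n - n) * (ψ n - ψ (n + 1)) :=
      mul_le_mul_of_nonneg_right h7 (by linarith)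
    nlinarith

theorem FClass.exists_regularSequence {ψ : ℝ → ℝ} (h : FClass ψ) :
    ∃ K ≥ 0, ∃ r > 0, r ≤ 1 / 2 ∧ ∃ L,
      RegularSequence (fun k : ℕ => ψ k) (etaGap ψ) K r L := by
  obtain ⟨K, hK0, hK⟩ := h.exists_eta_sub_le
  have hM := h.1
  have hanti := hM.strictAntiOn.antitoneOn
  obtain ⟨L, hL⟩ := exists_nat_ge (K + 4)
  have hL4 : 4 ≤ L := by exact_mod_cast (show (4 : ℝ) ≤ L by linarith)
  have hL4' : (4 : ℝ) ≤ L := by linarith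
  obtain ⟨L', hL'⟩ := exists_nat_ge (2 * (|eta ψ 1| + K + 1))
  have hlog2 : 0 < log 2 := log_pos one_lt_two
  have hlogL : 2 * log 2 ≤ log L := by
    have h1 := log_le_log (by norm_num) hL4'
    rwa [show (4 : ℝ) = 2 ^ 2 by norm_num, log_pow, Nat.cast_ofNat] at h1
  have hr : 0 < log 2 / log L := div_pos hlog2 (by linarith)
  refine ⟨2 * K + etaGap ψ 1, by positivity, log 2 / log L, hr, ?_, L', ?_⟩
  · rw [div_le_div_iff₀ (by linarith) two_pos]
    linarith
  have hLr : (L : ℝ) ^ (log 2 / log L) = 2 := by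
    rw [rpow_def_of_pos (by linarith), mul_div_cancel₀ _ (by linarith), exp_log two_pos]
  refine ⟨fun k hk => hM.1 k (by exact_mod_cast hk), hM.2.2.comp tendsto_natCast_atTop_atTop,
    fun n hn => ?_, fun n _ => one_le_etaGap ψ n, fun n hn => ?_⟩
  · have hn1 : (1 : ℝ) ≤ n := by exact_mod_cast hn
    have hnk : ∀ k : ℕ, (1 : ℝ) ≤ (n + k : ℕ) := fun k => by
      push_cast
      linarith [(Nat.cast_nonneg k : (0 : ℝ) ≤ k)]
    refine ⟨fun i j hij => ?_, fun k => (hM.1 _ (hnk k)).le,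
      antitone_nat_of_succ_le fun k => ?_, ?_, fun k => ?_⟩
    · exact hanti (hnk i) (hnk j) (by exact_mod_cast Nat.add_le_add_left hij n)
    · have h1 := hM.2.1.slope_mono_adjacent (hnk k) (hnk (k + 2))
        (show ((n + k : ℕ) : ℝ) < (n + (k + 1) : ℕ) by push_cast; linarith)
        (show ((n + (k + 1) : ℕ) : ℝ) < (n + (k + 2) : ℕ) by push_cast; linarith)
      rw [show ((n + (k + 1) : ℕ) : ℝ) - (n + k : ℕ) = 1 by push_cast; ring,
        show ((n + (k + 2) : ℕ) : ℝ) - (n + (k + 1) : ℕ) = 1 by push_cast; ring,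
        div_one, div_one] at h1
      rw [add_assoc k 1 1]
      linarith
    · simpa using hM.etaGap_mul_sub_le hK0 hK hn
    · simpa using hM.decay hK (by linarith) (by omega) hr hLr hn k
  · have hn1 : (1 : ℝ) ≤ n := by exact_mod_cast hn
    have h1 := hK 1 n le_rfl hn1
    have h2 := etaGap_le ψ n
    have h3 : max (eta ψ n - n) 1 ≤ (|eta ψ 1| + K + 1) * n := by
      have := abs_nonneg (eta ψ 1)
      have := le_abs_self (eta ψ 1)
      refine max_le ?_ ?_ <;> nlinarith
    have h4 : (etaGap ψ n : ℝ) ≤ L' * n := by nlinarith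
    exact_mod_cast h4

theorem MClass.exists_abs_log_etaGap_sub_le {ψ : ℝ → ℝ} (h : MClass ψ) :
    ∃ C ≥ 0, ∀ n : ℕ, 1 ≤ n → |log (etaGap ψ n) - max (log (eta ψ n - n)) 0| ≤ C := by
  refine ⟨log 2 + |log (etaGap ψ 1) - max (log (eta ψ (1 : ℕ) - (1 : ℕ))) 0|, by positivity,
    fun n hn => ?_⟩
  rcases hn.eq_or_lt with rfl | hn2
  · linarith [log_pos one_lt_two]
  obtain ⟨h1, -⟩ := h.eta_spec (show (1 : ℝ) < n by exact_mod_cast hn2)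
  have hmax : max (log (eta ψ n - n)) 0 = log (max (eta ψ n - n) 1) := by
    rcases le_total (eta ψ n - n) 1 with hm | hm
    · rw [max_eq_right hm, log_one, max_eq_right (log_nonpos (by linarith) hm)]
    · rw [max_eq_left hm, max_eq_left (log_nonneg hm)]
  have hpos : 0 < max (eta ψ n - n) 1 := by positivity
  have h2 := log_le_log hpos (le_etaGap ψ n)
  have h3 := log_le_log (hpos.trans_le (le_etaGap ψ n)) (etaGap_le ψ n)
  rw [log_mul two_ne_zero hpos.ne'] at h3
  rw [hmax, abs_of_nonneg (by linarith)]
  linarith [abs_nonneg (log (etaGap ψ 1) - max (log (eta ψ (1 : ℕ) - (1 : ℕ))) 0)]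

/-- for `ψ ∈ F` there is `C = C(ψ) > 0` with
`|E(C^ψ_{β,∞}; S_{n-1}) - (4/π²) ψ(n) ln⁺(η(ψ;n) - n)| ≤ C ψ(n)` for all `n` and `β`. -/
theorem statement2 (ψ : ℝ → ℝ) (hψ : FClass ψ) :
    ∃ C > (0 : ℝ), ∀ (β : ℝ) (n : ℕ), 1 ≤ n →
      |classSup (fun k : ℕ => ψ k) β (FourierSum n) -
        4 / π ^ 2 * ψ n * max (Real.log (eta ψ n - n)) 0| ≤ C * ψ n := by
  obtain ⟨K, hK, r, hr0, hr1, L, hreg⟩ := hψ.exists_regularSequence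
  obtain ⟨C, hC0, hC⟩ := hreg.exists_abs_classSup_sub_le hK hr0 hr1
  obtain ⟨D, hD0, hD⟩ := hψ.1.exists_abs_log_etaGap_sub_le
  refine ⟨C + 4 / π ^ 2 * D, by positivity, fun β n hn => ?_⟩
  have hpos := hψ.1.1 n (by exact_mod_cast hn)
  have h2 := mul_le_mul_of_nonneg_left (hD n hn) (show 0 ≤ 4 / π ^ 2 * ψ n by positivity)
  rw [← abs_of_nonneg (show 0 ≤ 4 / π ^ 2 * ψ n by positivity), ← abs_mul, mul_sub,
    abs_of_nonneg (show 0 ≤ 4 / π ^ 2 * ψ n by positivity)] at h2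
  refine (abs_sub_le _ (4 / π ^ 2 * ψ n * log (etaGap ψ n)) _).trans
    ((add_le_add (hC β n hn) h2).trans_eq ?_)
  ring
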